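/- arXiv:1411.4561 — 2 statements merged into one kernel-verified Lean document; each statement's English description precedes it below -/
import Mathlib

section
/- For every integer n ≥ 1, the number of fully commutative involutions in the Coxeter group of type A_{n-1} equals the binomial coefficient C(n, ⌊n/2⌋). -/
open CoxeterSystem

/-- A single commutation move: transposition of two adjacent letters `a`, `b`
with `M a b = 2`. -/
def CommMove {B : Type*} (M : CoxeterMatrix B) (w w' : List B) : Prop :=
  ∃ (u v : List B) (a b : B), M a b = 2 ∧ w = u ++ a :: b :: v ∧ w' = u ++ b :: a :: v

/-- Commutation equivalence of words: two words are commutation-equivalent if one can be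
obtained from the other by a sequence of transpositions of adjacent commuting letters. -/
def CommEquiv {B : Type*} (M : CoxeterMatrix B) : List B → List B → Prop :=
  Relation.EqvGen (CommMove M)

/-- An element is fully commutative if all its reduced words are commutation-equivalent. -/
def IsFullyCommutative {B W : Type*} [Group W] {M : CoxeterMatrix B}
    (cs : CoxeterSystem M W) (w : W) : Prop :=
  ∀ u v : List B, cs.IsReduced u → cs.wordProd u = w →
    cs.IsReduced v → cs.wordProd v = w → CommEquiv M u v

/-- A fully commutative involution (the identity is allowed). -/
def IsFCInvolution {B W : Type*} [Group W] {M : CoxeterMatrix B}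
    (cs : CoxeterSystem M W) (w : W) : Prop :=
  IsFullyCommutative cs w ∧ w * w = 1

/-- The Coxeter matrix of type `A_n`: generators `s_1, …, s_n` (index `k : Fin n`
corresponds to `s_{k+1}`), with `m(s_i, s_j) = 3` if `|i - j| = 1`
and `m(s_i, s_j) = 2` if `|i - j| ≥ 2`. -/
def typeA (n : ℕ) : CoxeterMatrix (Fin n) where
  M := Matrix.of fun i j : Fin n =>
    if (i : ℕ) = (j : ℕ) then 1
    else if (i : ℕ) + 1 = (j : ℕ) ∨ (j : ℕ) + 1 = (i : ℕ) then 3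
    else 2
  isSymm := by
    ext i j
    simp only [Matrix.transpose_apply, Matrix.of_apply]
    split_ifs <;> omega
  diagonal := by intro i; simp [Matrix.of_apply]
  off_diagonal := by
    intro i j hij
    have h : (i : ℕ) ≠ (j : ℕ) := fun h => hij (Fin.ext h)
    simp only [Matrix.of_apply]
    split_ifs <;> omega

/-! ### Commutation equivalence -/

theorem CommEquiv.perm {B : Type*} {M : CoxeterMatrix B} {u v : List B} (h : CommEquiv M u v) :
    u.Perm v := by
  induction h with
  | rel _ _ h =>
    obtain ⟨u, v, a, b, -, rfl, rfl⟩ := h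
    exact (List.Perm.swap _ _ _).append_left u
  | refl => exact .refl _
  | symm _ _ _ ih => exact ih.symm
  | trans _ _ _ _ _ ih1 ih2 => exact ih1.trans ih2

theorem CommEquiv.append_right {B : Type*} {M : CoxeterMatrix B} {u v : List B}
    (h : CommEquiv M u v) (t : List B) : CommEquiv M (u ++ t) (v ++ t) := by
  induction h with
  | rel _ _ h =>
    obtain ⟨u, v, a, b, hab, rfl, rfl⟩ := h
    exact .rel _ _ ⟨u, v ++ t, a, b, hab, by simp, by simp⟩
  | refl => exact .refl _
  | symm _ _ _ ih => exact ih.symm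
  | trans _ _ _ _ _ ih1 ih2 => exact ih1.trans _ _ _ ih2

namespace TypeA

variable {m : ℕ}

open Equiv

/-- The adjacent transposition `(i, i+1)` of `Fin (m + 1)`. -/
def adjSwap (i : Fin m) : Perm (Fin (m + 1)) := swap i.castSucc i.succ

theorem adjSwap_val (i : Fin m) (x : Fin (m + 1)) :
    ((adjSwap i x : Fin (m + 1)) : ℕ) =
      if (x : ℕ) = i then (i : ℕ) + 1 else if (x : ℕ) = i + 1 then (i : ℕ) else x := by
  simp only [adjSwap, swap_apply_def, Fin.ext_iff, Fin.val_castSucc, Fin.val_succ]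
  split_ifs <;> simp

theorem adjSwap_mul_self (i : Fin m) : adjSwap i * adjSwap i = 1 := swap_mul_self _ _

@[simp] theorem adjSwap_castSucc (i : Fin m) : adjSwap i i.castSucc = i.succ := swap_apply_left _ _

@[simp] theorem adjSwap_succ (i : Fin m) : adjSwap i i.succ = i.castSucc := swap_apply_right _ _

theorem typeA_apply (i j : Fin m) : typeA m i j = if (i : ℕ) = (j : ℕ) then 1
    else if (i : ℕ) + 1 = (j : ℕ) ∨ (j : ℕ) + 1 = (i : ℕ) then 3 else 2 := rfl

theorem isLiftable_adjSwap : (typeA m).IsLiftable (adjSwap (m := m)) := by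
  intro i j
  rw [typeA_apply]
  split_ifs with h1 h2
  · obtain rfl : i = j := Fin.ext h1
    simp [adjSwap_mul_self]
  · ext x
    simp only [pow_succ, pow_zero, one_mul, Perm.mul_apply, Perm.one_apply, adjSwap_val]
    grind
  · ext x
    simp only [pow_succ, pow_zero, one_mul, Perm.mul_apply, Perm.one_apply, adjSwap_val]
    grind

/-- The Coxeter system of type `A`. -/
abbrev cs (m : ℕ) : CoxeterSystem (typeA m) (typeA m).Group := (typeA m).toCoxeterSystem

/-- The permutation representation of the Coxeter group of type `A`. -/
def toPerm (m : ℕ) : (typeA m).Group →* Perm (Fin (m + 1)) :=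
  (cs m).lift ⟨adjSwap, isLiftable_adjSwap⟩

@[simp] theorem toPerm_simple (i : Fin m) : toPerm m ((cs m).simple i) = adjSwap i :=
  (cs m).lift_apply_simple isLiftable_adjSwap i

theorem toPerm_surjective : Function.Surjective (toPerm m) := by
  rw [← MonoidHom.mrange_eq_top, ← top_le_iff, ← Perm.mclosure_swap_castSucc_succ,
    Submonoid.closure_le]
  rintro _ ⟨i, rfl⟩
  exact ⟨(cs m).simple i, toPerm_simple i⟩

theorem simple_comm (i j : Fin m) (h : (i : ℕ) + 2 ≤ j ∨ (j : ℕ) + 2 ≤ i) :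
    (cs m).simple i * (cs m).simple j = (cs m).simple j * (cs m).simple i := by
  have := (cs m).simple_mul_simple_pow i j
  rw [typeA_apply, if_neg (by omega), if_neg (by omega), pow_two] at this
  rw [eq_inv_of_mul_eq_one_left this]
  simp [-CoxeterMatrix.toCoxeterSystem_simple]

theorem simple_braid (i j : Fin m) (h : (i : ℕ) + 1 = j ∨ (j : ℕ) + 1 = i) :
    (cs m).simple i * (cs m).simple j * (cs m).simple i =
      (cs m).simple j * (cs m).simple i * (cs m).simple j := by
  have := (cs m).simple_mul_simple_pow i j
  rw [typeA_apply, if_neg (by omega), if_pos h, pow_succ, pow_two] at this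
  have h2 : ((cs m).simple i * (cs m).simple j * (cs m).simple i) *
    ((cs m).simple j * (cs m).simple i * (cs m).simple j) = 1 := by
    simpa [mul_assoc] using this
  rw [eq_inv_of_mul_eq_one_left h2]
  simp [mul_assoc, -CoxeterMatrix.toCoxeterSystem_simple]

/-- The simple reflections, indexed by all natural numbers (out of range indices give `1`). -/
def gen (m i : ℕ) : (typeA m).Group := if h : i < m then (cs m).simple ⟨i, h⟩ else 1

theorem gen_val (i : Fin m) : gen m i = (cs m).simple i := by simp [gen]

theorem gen_mul_self (i : ℕ) : gen m i * gen m i = 1 := by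
  unfold gen; split_ifs <;> simp [-CoxeterMatrix.toCoxeterSystem_simple]

theorem gen_comm (i j : ℕ) (h : i + 2 ≤ j ∨ j + 2 ≤ i) :
    gen m i * gen m j = gen m j * gen m i := by
  unfold gen; split_ifs <;> first | exact simple_comm _ _ h | simp

theorem gen_braid (i : ℕ) (h : i + 1 < m) :
    gen m (i + 1) * gen m i * gen m (i + 1) = gen m i * gen m (i + 1) * gen m i := by
  rw [gen, gen, dif_pos h, dif_pos (by omega)]
  exact simple_braid _ _ (by simp)

/-- The descending product `s_k s_{k-1} ⋯` of `t` simple reflections. -/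
def chain (m k : ℕ) : ℕ → (typeA m).Group
  | 0 => 1
  | t + 1 => chain m k t * gen m (k - t)

theorem chain_comm (k j t : ℕ) (h : j + t < k + 1) :
    chain m k t * gen m j = gen m j * chain m k t ∨ j + t = k := by
  induction t with
  | zero => simp [chain]
  | succ t ih =>
    have ih := (ih (by omega)).resolve_right (by omega)
    by_cases hj : j + (t + 1) = k
    · exact .inr hj
    · left
      rw [chain, mul_assoc, gen_comm (k - t) j (by omega), ← mul_assoc, ih, mul_assoc]

theorem chain_shift (k j t : ℕ) (hk : k < m) (ht : t ≤ k + 1) (hj : k + 1 < j + 1 + t)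
    (hjk : j + 1 ≤ k) : chain m k t * gen m (j + 1) = gen m j * chain m k t := by
  induction t with
  | zero => omega
  | succ t ih =>
    by_cases h : k + 1 < j + 1 + t
    · rw [chain, mul_assoc, gen_comm (k - t) (j + 1) (by omega), ← mul_assoc, ih (by omega) h,
        mul_assoc]
    · obtain ⟨t, rfl⟩ : ∃ t', t = t' + 1 := ⟨t - 1, by omega⟩
      have h1 : k - (t + 1) = j := by omega
      have h2 : k - t = j + 1 := by omega
      have h3 := (chain_comm (m := m) k j t (by omega)).resolve_right (by omega)
      rw [chain, chain, h1, h2]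
      calc _ = chain m k t * (gen m (j + 1) * gen m j * gen m (j + 1)) := by simp [mul_assoc]
        _ = chain m k t * gen m j * gen m (j + 1) * gen m j := by
          rw [gen_braid j (by omega)]; simp [mul_assoc]
        _ = _ := by rw [h3]; simp [mul_assoc]

/-- The parabolic subgroup generated by the first `k` simple reflections. -/
def parabolic (m k : ℕ) : Subgroup (typeA m).Group := Subgroup.closure (gen m '' Set.Iio k)

theorem gen_mem_parabolic {j k : ℕ} (h : j < k) : gen m j ∈ parabolic m k :=
  Subgroup.subset_closure ⟨j, h, rfl⟩

theorem exists_chain {k : ℕ} (hk : k < m) {w : (typeA m).Group} (hw : w ∈ parabolic m (k + 1)) :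
    ∃ x ∈ parabolic m k, ∃ t ≤ k + 1, w = x * chain m k t := by
  have step : ∀ y, (∃ x ∈ parabolic m k, ∃ t ≤ k + 1, y = x * chain m k t) → ∀ j ≤ k,
      ∃ x ∈ parabolic m k, ∃ t ≤ k + 1, y * gen m j = x * chain m k t := by
    rintro y ⟨x, hx, t, ht, rfl⟩ j hj
    rcases lt_trichotomy (j + t) k with h | h | h
    · refine ⟨x * gen m j, mul_mem hx (gen_mem_parabolic (by omega)), t, ht, ?_⟩
      rw [mul_assoc, (chain_comm k j t (by omega)).resolve_right (by omega), mul_assoc]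
    · refine ⟨x, hx, t + 1, by omega, ?_⟩
      rw [chain, mul_assoc, show k - t = j by omega]
    · obtain ⟨t, rfl⟩ : ∃ t', t = t' + 1 := ⟨t - 1, by omega⟩
      by_cases h2 : j + t = k
      · refine ⟨x, hx, t, by omega, ?_⟩
        rw [chain, show k - t = j by omega, mul_assoc, mul_assoc, gen_mul_self, mul_one]
      · obtain ⟨j, rfl⟩ : ∃ j', j = j' + 1 := ⟨j - 1, by omega⟩
        refine ⟨x * gen m j, mul_mem hx (gen_mem_parabolic (by omega)), t + 1, ht, ?_⟩
        rw [mul_assoc, chain_shift k j _ hk ht (by omega) hj, mul_assoc]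
  induction hw using Subgroup.closure_induction_right with
  | one => exact ⟨1, one_mem _, 0, by omega, by simp [chain]⟩
  | mul_right y _ s hs ih =>
    obtain ⟨j, hj, rfl⟩ := hs
    exact step y ih j (Nat.le_of_lt_succ hj)
  | mul_inv_cancel y _ s hs ih =>
    obtain ⟨j, hj, rfl⟩ := hs
    rw [inv_eq_of_mul_eq_one_right (gen_mul_self j)]
    exact step y ih j (Nat.le_of_lt_succ hj)

theorem toPerm_gen {j : ℕ} (h : j < m) : toPerm m (gen m j) = adjSwap ⟨j, h⟩ := by
  rw [gen, dif_pos h, toPerm_simple]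

theorem toPerm_chain (k t : ℕ) (hk : k < m) (ht : t ≤ k + 1) :
    toPerm m (chain m k t) ⟨k + 1 - t, by omega⟩ = ⟨k + 1, by omega⟩ := by
  induction t with
  | zero => simp [chain]
  | succ t ih =>
    rw [chain, map_mul, toPerm_gen (by omega), Perm.mul_apply]
    convert ih (by omega)
    simp [adjSwap_val]
    omega

theorem toPerm_parabolic {k : ℕ} (hk : k < m) {w : (typeA m).Group} (hw : w ∈ parabolic m k) :
    toPerm m w ⟨k + 1, by omega⟩ = ⟨k + 1, by omega⟩ := by
  induction hw using Subgroup.closure_induction with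
  | mem x hx =>
    obtain ⟨j, hj, rfl⟩ := hx
    have hj : j < k := hj
    rw [toPerm_gen (by omega), Fin.ext_iff, adjSwap_val]
    dsimp only
    split_ifs <;> omega
  | one => simp
  | mul x y _ _ hx hy => rw [map_mul, Perm.mul_apply, hy, hx]
  | inv x _ hx => rw [map_inv, Perm.inv_eq_iff_eq, hx]

theorem eq_one_of_mem_parabolic {k : ℕ} (hk : k ≤ m) {w : (typeA m).Group}
    (hw : w ∈ parabolic m k) (h : toPerm m w = 1) : w = 1 := by
  induction k generalizing w with
  | zero => simpa [parabolic] using hw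
  | succ k ih =>
    obtain ⟨x, hx, t, ht, rfl⟩ := exists_chain hk hw
    have h1 := toPerm_chain k t hk ht
    have h2 := toPerm_parabolic hk hx
    rw [← h1, ← Perm.mul_apply, ← map_mul, h, h1, Perm.one_apply, Fin.ext_iff] at h2
    obtain rfl : t = 0 := by simp at h2; omega
    rw [chain, mul_one] at h ⊢
    exact ih (by omega) hx h

theorem toPerm_injective : Function.Injective (toPerm m) := by
  rw [injective_iff_map_eq_one]
  intro w
  refine eq_one_of_mem_parabolic le_rfl ?_
  suffices parabolic m m = ⊤ by simp [this]
  rw [← top_le_iff, ← (cs m).subgroup_closure_range_simple]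
  refine Subgroup.closure_mono ?_
  rintro _ ⟨i, rfl⟩
  exact ⟨i, i.2, gen_val i⟩

/-! ### Length and inversions -/

/-- The set of inversions of a permutation. -/
def inversions (σ : Perm (Fin (m + 1))) : Finset (Fin (m + 1) × Fin (m + 1)) :=
  {p | p.1 < p.2 ∧ σ p.2 < σ p.1}

theorem mem_inversions {σ : Perm (Fin (m + 1))} {p : Fin (m + 1) × Fin (m + 1)} :
    p ∈ inversions σ ↔ p.1 < p.2 ∧ σ p.2 < σ p.1 := by
  simp [inversions]

theorem card_inversions_mul_adjSwap {σ : Perm (Fin (m + 1))} {i : Fin m}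
    (h : σ i.castSucc < σ i.succ) :
    (inversions (σ * adjSwap i)).card = (inversions σ).card + 1 := by
  have key : inversions (σ * adjSwap i) = insert (i.castSucc, i.succ)
      ((inversions σ).map ((adjSwap i).prodCongr (adjSwap i)).toEmbedding) := by
    ext ⟨a, b⟩
    have hs : (adjSwap i).symm = adjSwap i := symm_swap _ _
    rw [Finset.mem_insert, Finset.mem_map_equiv]
    simp only [mem_inversions, Perm.mul_apply,
      prodCongr_symm, hs, prodCongr_apply, Prod.map_apply, Prod.mk.injEq]
    by_cases h1 : a = i.castSucc ∧ b = i.succ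
    · obtain ⟨rfl, rfl⟩ := h1
      simp [h]
    by_cases h2 : a = i.succ ∧ b = i.castSucc
    · obtain ⟨rfl, rfl⟩ := h2
      simp [h.not_gt, Fin.ext_iff]
    have h3 : a < b ↔ adjSwap i a < adjSwap i b := by
      simp only [Fin.ext_iff, Fin.lt_def, adjSwap_val, Fin.val_castSucc, Fin.val_succ] at *
      split_ifs <;> omega
    rw [h3]
    simp [h1]
  rw [key, Finset.card_insert_of_notMem, Finset.card_map]
  rw [Finset.mem_map_equiv]
  simp [mem_inversions, adjSwap, (Fin.castSucc_lt_succ (i := i)).le]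

theorem mul_adjSwap_mul_adjSwap (σ : Perm (Fin (m + 1))) (i : Fin m) :
    σ * adjSwap i * adjSwap i = σ := by
  rw [mul_assoc, adjSwap_mul_self, mul_one]

theorem card_inversions_of_descent {σ : Perm (Fin (m + 1))} {i : Fin m}
    (h : σ i.succ < σ i.castSucc) :
    (inversions σ).card = (inversions (σ * adjSwap i)).card + 1 := by
  rw [← card_inversions_mul_adjSwap (i := i) (by simpa using h), mul_adjSwap_mul_adjSwap]

theorem lt_or_gt_adj (σ : Perm (Fin (m + 1))) (i : Fin m) :
    σ i.castSucc < σ i.succ ∨ σ i.succ < σ i.castSucc :=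
  lt_or_gt_of_ne fun h ↦ (Fin.castSucc_lt_succ (i := i)).ne (σ.injective h)

theorem exists_descent {σ : Perm (Fin (m + 1))} (h : σ ≠ 1) : ∃ i : Fin m,
    σ i.succ < σ i.castSucc := by
  by_contra! hc
  have hmono : StrictMono σ := Fin.strictMono_iff_lt_succ.2 fun i ↦
    (lt_or_gt_adj σ i).resolve_right (hc i).not_gt
  apply h
  have := Subsingleton.elim (hmono.orderIsoOfSurjective σ σ.surjective) (OrderIso.refl _)
  ext x
  exact congrArg Fin.val (DFunLike.congr_fun this x)

theorem length_eq_card_inversions (w : (typeA m).Group) :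
    (cs m).length w = (inversions (toPerm m w)).card := by
  apply le_antisymm
  · induction hn : (inversions (toPerm m w)).card generalizing w with
    | zero =>
      suffices w = 1 by simp [this]
      by_contra hw
      obtain ⟨i, hi⟩ := exists_descent fun h ↦ hw (toPerm_injective (h.trans (map_one _).symm))
      have := card_inversions_of_descent hi
      omega
    | succ n ih =>
      have hw : toPerm m w ≠ 1 := by
        intro h
        have h0 : inversions (1 : Perm (Fin (m + 1))) = ∅ := by
          ext p
          simp only [mem_inversions, Perm.one_apply, Finset.notMem_empty, iff_false]
          exact fun h ↦ h.1.not_gt h.2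
        simp [h, h0] at hn
      obtain ⟨i, hi⟩ := exists_descent hw
      have h1 := card_inversions_of_descent hi
      have h2 := ih (w * (cs m).simple i) (by rw [map_mul, toPerm_simple]; omega)
      have h3 := (cs m).length_mul_simple w i
      omega
  · obtain ⟨ω, hω, rfl⟩ := (cs m).exists_isReduced w
    rw [hω.eq]
    clear hω
    induction ω using List.reverseRecOn with
    | nil => simp [inversions, Finset.filter_eq_empty_iff]; grind
    | append_singleton ω i ih =>
      rw [← List.concat_eq_append, (cs m).wordProd_concat, map_mul, toPerm_simple,
        List.length_concat]
      rcases lt_or_gt_adj (toPerm m ((cs m).wordProd ω)) i with h | h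
      · rw [card_inversions_mul_adjSwap h]; omega
      · have := card_inversions_of_descent h
        omega

theorem isReduced_append_singleton {ω : List (Fin m)} {i : Fin m} :
    (cs m).IsReduced (ω ++ [i]) ↔ (cs m).IsReduced ω ∧
      toPerm m ((cs m).wordProd ω) i.castSucc < toPerm m ((cs m).wordProd ω) i.succ := by
  have h1 := (cs m).length_wordProd_le ω
  simp only [CoxeterSystem.IsReduced, ← List.concat_eq_append, (cs m).wordProd_concat,
    List.length_concat]
  rw [length_eq_card_inversions] at *
  rw [length_eq_card_inversions, map_mul, toPerm_simple]
  rcases lt_or_gt_adj (toPerm m ((cs m).wordProd ω)) i with h | h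
  · rw [card_inversions_mul_adjSwap h]; simp [h]
  · have := card_inversions_of_descent h
    have := h.not_gt
    constructor
    · omega
    · tauto

theorem exists_isReduced_append_of_descent {w : (typeA m).Group} {i : Fin m}
    (h : toPerm m w i.succ < toPerm m w i.castSucc) {ω : List (Fin m)} (hω : (cs m).IsReduced ω)
    (hp : (cs m).wordProd ω = w * (cs m).simple i) :
    (cs m).IsReduced (ω ++ [i]) ∧ (cs m).wordProd (ω ++ [i]) = w := by
  constructor
  · rw [isReduced_append_singleton, hp, map_mul, toPerm_simple]
    exact ⟨hω, by simpa using h⟩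
  · rw [← List.concat_eq_append, (cs m).wordProd_concat, hp,
      CoxeterSystem.simple_mul_simple_cancel_right]

/-! ### Counting 321-avoiding involutions -/

open Classical in
/-- Involutions of `Fin N` supported on `Q ∪ R`, mapping `Q` into `R`, such that no fixed point lies
below an arc and no two arcs are nested. -/
noncomputable def arcInvolutions {N : ℕ} (Q R : Finset (Fin N)) : Finset (Perm (Fin N)) :=
  {σ | (∀ x, σ (σ x) = x) ∧ (∀ x, x ∉ Q → x ∉ R → σ x = x) ∧ (∀ q ∈ Q, σ q ∈ R) ∧
    ∀ a b, (a ∈ Q ∨ a ∈ R) → (b ∈ Q ∨ b ∈ R) → a < b → b ≤ σ b → σ a < σ b}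

theorem mem_arcInvolutions {N : ℕ} {Q R : Finset (Fin N)} {σ : Perm (Fin N)} :
    σ ∈ arcInvolutions Q R ↔ (∀ x, σ (σ x) = x) ∧ (∀ x, x ∉ Q → x ∉ R → σ x = x) ∧
    (∀ q ∈ Q, σ q ∈ R) ∧
    ∀ a b, (a ∈ Q ∨ a ∈ R) → (b ∈ Q ∨ b ∈ R) → a < b → b ≤ σ b → σ a < σ b := by
  simp [arcInvolutions]

theorem arcInvolutions_opener {N : ℕ} {Q R : Finset (Fin N)} {r : Fin N}
    (hQ : ∀ q ∈ Q, q < r) (hR : ∀ x ∈ R, r < x) :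
    arcInvolutions (insert r Q) R = {σ ∈ arcInvolutions Q (insert r R) | r < σ r} := by
  ext σ
  simp only [Finset.mem_filter, mem_arcInvolutions, Finset.mem_insert]
  constructor
  · rintro ⟨h1, h2, h3, h4⟩
    refine ⟨⟨h1, ?_, ?_, ?_⟩, ?_⟩ <;> grind
  · rintro ⟨⟨h1, h2, h3, h4⟩, h5⟩
    refine ⟨h1, ?_, ?_, ?_⟩ <;> grind

theorem arcInvolutions_fixed {N : ℕ} {R : Finset (Fin N)} {r : Fin N} (hR : ∀ x ∈ R, r < x) :
    arcInvolutions ∅ R = {σ ∈ arcInvolutions ∅ (insert r R) | ¬ r < σ r} := by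
  ext σ
  simp only [Finset.mem_filter, mem_arcInvolutions, Finset.mem_insert, Finset.notMem_empty]
  constructor
  · rintro ⟨h1, h2, h3, h4⟩
    have h6 : ∀ x ∈ R, σ x ∈ R := by grind
    refine ⟨⟨h1, ?_, ?_, ?_⟩, ?_⟩ <;> grind
  · rintro ⟨⟨h1, h2, h3, h4⟩, h5⟩
    have : σ r = r := by grind
    refine ⟨h1, ?_, ?_, ?_⟩ <;> grind

theorem card_arcInvolutions_closer {N : ℕ} {Q R : Finset (Fin N)} {q r : Fin N}
    (hq : ∀ x ∈ Q, q < x) (hQ : ∀ x ∈ Q, x < r) (hqr : q < r) (hR : ∀ x ∈ R, r < x) :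
    (arcInvolutions Q R).card =
      {σ ∈ arcInvolutions (insert q Q) (insert r R) | ¬ r < σ r}.card := by
  refine Finset.card_bij' (fun σ _ ↦ swap q r * σ) (fun σ _ ↦ swap q r * σ) ?_ ?_ ?_ ?_
  · intro σ hσ
    simp only [Finset.mem_filter, mem_arcInvolutions, Finset.mem_insert, Perm.mul_apply,
      swap_apply_def] at hσ ⊢
    obtain ⟨h1, h2, h3, h4⟩ := hσ
    have hq1 : σ q = q := by grind
    have hr1 : σ r = r := by grind
    have hn : ∀ x, x ≠ q → x ≠ r → σ x ≠ q ∧ σ x ≠ r := by grind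
    refine ⟨⟨?_, ?_, ?_, ?_⟩, ?_⟩ <;> grind
  · intro σ hσ
    simp only [Finset.mem_filter, mem_arcInvolutions, Finset.mem_insert, Perm.mul_apply,
      swap_apply_def] at hσ ⊢
    obtain ⟨⟨h1, h2, h3, h4⟩, h5⟩ := hσ
    have hr1 : σ r = q := by grind
    have hq1 : σ q = r := by grind
    have hn : ∀ x, x ≠ q → x ≠ r → σ x ≠ q ∧ σ x ≠ r := by grind
    refine ⟨?_, ?_, ?_, ?_⟩ <;> grind
  · intro σ _; simp [← mul_assoc]
  · intro σ _; simp [← mul_assoc]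

theorem card_arcInvolutions {N : ℕ} (k : ℕ) (Q R : Finset (Fin N)) (hR : R.card = k)
    (hQR : ∀ q ∈ Q, ∀ r ∈ R, q < r) :
    (arcInvolutions Q R).card = k.choose ((k + Q.card + 1) / 2) := by
  induction k generalizing Q R with
  | zero =>
    obtain rfl := Finset.card_eq_zero.1 hR
    rcases Q.eq_empty_or_nonempty with rfl | ⟨q, hq⟩
    · suffices arcInvolutions ∅ ∅ = {(1 : Perm (Fin N))} by simp [this]
      ext σ
      simp only [mem_arcInvolutions, Finset.mem_singleton, Finset.notMem_empty, Perm.ext_iff,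
        Perm.one_apply]
      grind
    · have h1 := Finset.card_pos.2 ⟨q, hq⟩
      rw [Nat.choose_eq_zero_of_lt (by omega), Finset.card_eq_zero, Finset.eq_empty_iff_forall_notMem]
      intro σ hσ
      simpa using (mem_arcInvolutions.1 hσ).2.2.1 q hq
  | succ k ih =>
    have hne : R.Nonempty := Finset.card_pos.1 (by omega)
    obtain ⟨r, R', hr, rfl, hlt⟩ : ∃ r R', r ∉ R' ∧ insert r R' = R ∧ ∀ x ∈ R', r < x := by
      refine ⟨R.min' hne, R.erase (R.min' hne), by simp, Finset.insert_erase (R.min'_mem hne), ?_⟩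
      exact fun x hx ↦ R.min'_lt_of_mem_erase_min' hne hx
    have hR' : R'.card = k := by
      rw [Finset.card_insert_of_notMem hr] at hR; omega
    have hQr : ∀ q ∈ Q, q < r := fun q hq ↦ hQR q hq r (by simp)
    rw [← Finset.card_filter_add_card_filter_not (fun σ : Perm (Fin N) ↦ r < σ r),
      ← arcInvolutions_opener hQr hlt, ih _ _ hR' (by grind),
      Finset.card_insert_of_notMem (fun h ↦ (hQr r h).false)]
    rcases Q.eq_empty_or_nonempty with rfl | hQne
    · rw [← arcInvolutions_fixed hlt, ih _ _ hR' (by simp)]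
      simp only [Finset.card_empty, add_zero, zero_add]
      rw [show (k + 1 + 1) / 2 = k / 2 + 1 by omega, Nat.choose_succ_succ, add_comm]
      congr 1
      exact Nat.choose_symm_of_eq_add (by omega)
    · obtain ⟨q, Q', hq, rfl, hqlt⟩ : ∃ q Q', q ∉ Q' ∧ insert q Q' = Q ∧ ∀ x ∈ Q', q < x := by
        refine ⟨Q.min' hQne, Q.erase (Q.min' hQne), by simp,
          Finset.insert_erase (Q.min'_mem hQne), ?_⟩
        exact fun x hx ↦ Q.min'_lt_of_mem_erase_min' hQne hx
      rw [← card_arcInvolutions_closer hqlt (by grind) (by grind) hlt, ih _ _ hR' (by grind),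
        Finset.card_insert_of_notMem hq,
        show (k + 1 + (Q'.card + 1) + 1) / 2 = (k + Q'.card + 1) / 2 + 1 by omega,
        Nat.choose_succ_succ, add_comm]
      congr 2
      omega

/-- A permutation contains the pattern `321`. -/
def Has321 {N : ℕ} (σ : Perm (Fin N)) : Prop :=
  ∃ a b c, a < b ∧ b < c ∧ σ c < σ b ∧ σ b < σ a

theorem card_involutions_not_has321 (N : ℕ) :
    Nat.card {σ : Perm (Fin N) // ¬ Has321 σ ∧ σ * σ = 1} = N.choose (N / 2) := by
  have key : ∀ σ : Perm (Fin N), σ ∈ arcInvolutions ∅ Finset.univ ↔ ¬ Has321 σ ∧ σ * σ = 1 := by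
    intro σ
    simp only [mem_arcInvolutions, Perm.ext_iff, Perm.mul_apply, Perm.one_apply, Has321,
      Finset.notMem_empty, Finset.mem_univ]
    constructor
    · rintro ⟨h1, -, -, h4⟩
      refine ⟨?_, h1⟩
      rintro ⟨a, b, c, hab, hbc, h5, h6⟩
      have := h4 a b (.inr trivial) (.inr trivial) hab
      have := h4 (σ c) (σ b) (.inr trivial) (.inr trivial) h5
      grind
    · rintro ⟨h1, h2⟩
      refine ⟨h2, by simp, by simp, fun a b _ _ hab hb ↦ ?_⟩
      by_contra! h
      have hne : σ b ≠ σ a := fun h' ↦ hab.ne' (σ.injective h')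
      have hlt : σ b < σ a := lt_of_le_of_ne h hne
      rcases hb.eq_or_lt with hb | hb
      · exact h1 ⟨a, b, σ a, by grind⟩
      · exact h1 ⟨a, b, σ b, by grind⟩
  rw [Nat.card_congr (Equiv.subtypeEquivRight fun σ ↦ (key σ).symm), Nat.card_eq_fintype_card,
    Fintype.card_coe, card_arcInvolutions N _ _ (by simp) (by simp)]
  exact Nat.choose_symm_of_eq_add (by simp; omega)

/-! ### Fully commutative elements -/

theorem has321_of_mul_adjSwap {σ : Perm (Fin (m + 1))} {i : Fin m}
    (h : σ i.succ < σ i.castSucc) (h3 : Has321 (σ * adjSwap i)) : Has321 σ := by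
  obtain ⟨a, b, c, hab, hbc, h1, h2⟩ := h3
  simp only [Perm.mul_apply] at h1 h2
  have key : ∀ x y : Fin (m + 1), x < y → σ (adjSwap i y) < σ (adjSwap i x) →
      adjSwap i x < adjSwap i y := by
    intro x y hxy hσ
    by_cases hx : x = i.castSucc ∧ y = i.succ
    · obtain ⟨rfl, rfl⟩ := hx
      rw [adjSwap_castSucc, adjSwap_succ] at hσ
      exact absurd h hσ.not_gt
    · simp only [Fin.ext_iff, Fin.lt_def, adjSwap_val, Fin.val_castSucc, Fin.val_succ] at hx hxy ⊢
      split_ifs <;> omega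
  exact ⟨_, _, _, key a b hab h2, key b c hbc h1, h1, h2⟩

/-- A permutation with a `321` pattern has either three consecutive decreasing values, or
a descent that can be removed keeping a `321` pattern. -/
theorem Has321.exists_descent {σ : Perm (Fin (m + 1))} (h : Has321 σ) :
    (∃ i j : Fin m, i.succ = j.castSucc ∧ σ i.succ < σ i.castSucc ∧ σ j.succ < σ j.castSucc) ∨
    ∃ i : Fin m, σ i.succ < σ i.castSucc ∧ Has321 (σ * adjSwap i) := by
  obtain ⟨a, b, c, hab, hbc, h1, h2⟩ := h
  induction hn : (c : ℕ) - a using Nat.strong_induction_on generalizing a c with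
  | _ n ih =>
  have sw : ∀ (i : Fin m) (x : Fin (m + 1)), x ≠ i.castSucc → x ≠ i.succ → adjSwap i x = x :=
    fun i x h h' ↦ swap_apply_of_ne_of_ne h h'
  obtain ⟨i, rfl⟩ : ∃ i : Fin m, a = i.castSucc :=
    ⟨⟨a, by omega⟩, rfl⟩
  obtain ⟨j, rfl⟩ : ∃ j : Fin m, c = j.succ :=
    ⟨⟨c - 1, by omega⟩, by ext; simp; omega⟩
  have hle : i.succ ≤ b := by simpa [Fin.le_def, Fin.lt_def, Nat.succ_le_iff] using hab
  have hge : b ≤ j.castSucc := by simpa [Fin.le_def, Fin.lt_def, Nat.lt_succ_iff] using hbc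
  rcases hle.lt_or_eq with hlt | rfl
  · rcases lt_or_gt_adj σ i with hi | hi
    · refine ih _ ?_ i.succ j.succ hlt hbc h1 (h2.trans hi) rfl
      simp only [Fin.lt_def, Fin.val_castSucc, Fin.val_succ] at *; omega
    · right
      refine ⟨i, hi, i.succ, b, j.succ, hlt, hbc, ?_, ?_⟩
      · rw [Perm.mul_apply, Perm.mul_apply, sw i b hab.ne' hlt.ne',
          sw i j.succ (hab.trans hbc).ne' (hlt.trans hbc).ne']
        exact h1
      · rw [Perm.mul_apply, Perm.mul_apply, sw i b hab.ne' hlt.ne', adjSwap_succ]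
        exact h2
  · rcases hge.lt_or_eq with hgt | hj
    · rcases lt_or_gt_adj σ j with hj | hj
      · refine ih _ ?_ i.castSucc j.castSucc hab hgt (hj.trans h1) h2 rfl
        simp only [Fin.lt_def, Fin.val_castSucc, Fin.val_succ] at *; omega
      · right
        refine ⟨j, hj, i.castSucc, i.succ, j.castSucc, hab, hgt, ?_, ?_⟩
        · rw [Perm.mul_apply, Perm.mul_apply, sw j i.succ hgt.ne hbc.ne, adjSwap_castSucc]
          exact h1
        · rw [Perm.mul_apply, Perm.mul_apply, sw j i.succ hgt.ne hbc.ne,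
            sw j i.castSucc (hab.trans hgt).ne (hab.trans hbc).ne]
          exact h2
    · exact .inl ⟨i, j, hj, h2, hj ▸ h1⟩

theorem exists_braid_word (w : (typeA m).Group) (h : Has321 (toPerm m w)) :
    ∃ (u v : List (Fin m)) (i j : Fin m), (i : ℕ) + 1 = j ∧
      (cs m).IsReduced (u ++ [i, j, i] ++ v) ∧ (cs m).wordProd (u ++ [i, j, i] ++ v) = w := by
  induction hn : (inversions (toPerm m w)).card using Nat.strong_induction_on generalizing w with
  | _ n ih =>
  rcases h.exists_descent with ⟨i, j, hij, hi, hj⟩ | ⟨i, hi, h3⟩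
  · have hij' : (i : ℕ) + 1 = j := congrArg Fin.val hij
    have sw1 : adjSwap i j.succ = j.succ :=
      swap_apply_of_ne_of_ne (by simp [Fin.ext_iff]; omega) (by simp [Fin.ext_iff]; omega)
    have sw2 : adjSwap j i.castSucc = i.castSucc :=
      swap_apply_of_ne_of_ne (by simp [Fin.ext_iff]; omega) (by simp [Fin.ext_iff]; omega)
    obtain ⟨u, hu, hu'⟩ := (cs m).exists_isReduced
      (w * (cs m).simple i * (cs m).simple j * (cs m).simple i)
    obtain ⟨h1, h1'⟩ := exists_isReduced_append_of_descent (i := i)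
      (w := w * (cs m).simple i * (cs m).simple j) (by
        simp only [map_mul, toPerm_simple, Perm.mul_apply]
        rw [hij, adjSwap_castSucc, sw1, sw2, adjSwap_castSucc, hij]
        exact hj) hu hu'.symm
    obtain ⟨h2, h2'⟩ := exists_isReduced_append_of_descent (i := j)
      (w := w * (cs m).simple i) (by
        simp only [map_mul, toPerm_simple, Perm.mul_apply]
        rw [sw1, ← hij, adjSwap_succ]
        exact hj.trans (hij ▸ hi)) h1 h1'
    obtain ⟨h4, h4'⟩ := exists_isReduced_append_of_descent hi h2 h2'
    exact ⟨u, [], i, j, hij', by simpa using h4, by simpa using h4'⟩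
  · have hc := card_inversions_of_descent hi
    obtain ⟨u, v, k, l, hkl, hr, hp⟩ := ih (n - 1) (by omega) (w * (cs m).simple i)
      (by rwa [map_mul, toPerm_simple]) (by rw [map_mul, toPerm_simple]; omega)
    obtain ⟨h4, h4'⟩ := exists_isReduced_append_of_descent hi hr hp
    exact ⟨u, v ++ [i], k, l, hkl, by simpa using h4, by simpa using h4'⟩

theorem not_isFullyCommutative_of_has321 {w : (typeA m).Group} (h : Has321 (toPerm m w)) :
    ¬ IsFullyCommutative (cs m) w := by
  intro hfc
  obtain ⟨u, v, i, j, hij, hr, hp⟩ := exists_braid_word w h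
  have hp' : (cs m).wordProd (u ++ [j, i, j] ++ v) = w := by
    rw [← hp]
    simp only [CoxeterSystem.wordProd_append, CoxeterSystem.wordProd_cons,
      CoxeterSystem.wordProd_nil, mul_one]
    have := congrArg ((cs m).wordProd u * · * (cs m).wordProd v) (simple_braid i j (.inl hij))
    simpa only [mul_assoc] using this.symm
  have hr' : (cs m).IsReduced (u ++ [j, i, j] ++ v) := by
    rw [CoxeterSystem.IsReduced, hp', ← hp, hr.eq]
    simp
  have := (CommEquiv.perm (hfc _ _ hr hp hr' hp')).count_eq i
  have hne : j ≠ i := fun h ↦ by simp [h] at hij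
  simp [hne] at this

theorem commEquiv_of_not_has321 {w : (typeA m).Group} (h : ¬ Has321 (toPerm m w))
    {u v : List (Fin m)} (hu : (cs m).IsReduced u) (hu' : (cs m).wordProd u = w)
    (hv : (cs m).IsReduced v) (hv' : (cs m).wordProd v = w) : CommEquiv (typeA m) u v := by
  induction hn : u.length generalizing w u v with
  | zero =>
    have hl : u.length = v.length := by rw [← hu.eq, ← hv.eq, hu', hv']
    rw [List.length_eq_zero_iff] at hn
    subst hn
    rw [List.length_nil, eq_comm, List.length_eq_zero_iff] at hl
    subst hl
    exact .refl _
  | succ n ih =>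
    have hl : u.length = v.length := by rw [← hu.eq, ← hv.eq, hu', hv']
    have eq_append_singleton : ∀ {l : List (Fin m)}, l.length = n + 1 → ∃ t k, l = t ++ [k] :=
      fun {l} hl ↦ ⟨l.dropLast, l.getLast (by rintro rfl; simp at hl),
        (List.dropLast_append_getLast _).symm⟩
    obtain ⟨u, i, rfl⟩ := eq_append_singleton hn
    obtain ⟨v, j, rfl⟩ := eq_append_singleton (hl.symm.trans hn)
    rw [← List.concat_eq_append, (cs m).wordProd_concat] at hu' hv'
    rw [isReduced_append_singleton] at hu hv
    simp only [List.length_append, List.length_singleton, Nat.add_right_cancel_iff] at hn hl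
    have descent : ∀ {k : Fin m} {w' : (typeA m).Group}, w' * (cs m).simple k = w →
        toPerm m w' k.castSucc < toPerm m w' k.succ →
        w' = w * (cs m).simple k ∧ toPerm m w k.succ < toPerm m w k.castSucc ∧
          ¬ Has321 (toPerm m w') := by
      rintro k w' rfl hk
      have hd : toPerm m (w' * (cs m).simple k) k.succ <
          toPerm m (w' * (cs m).simple k) k.castSucc := by
        rw [map_mul, toPerm_simple]; simpa using hk
      refine ⟨((cs m).simple_mul_simple_cancel_right k).symm, hd,
        fun h' ↦ h (has321_of_mul_adjSwap hd ?_)⟩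
      rwa [map_mul, toPerm_simple, mul_adjSwap_mul_adjSwap]
    obtain ⟨hui, hdi, h3i⟩ := descent hu' hu.2
    obtain ⟨hvj, hdj, h3j⟩ := descent hv' hv.2
    by_cases hij : i = j
    · subst hij
      exact (ih h3i hu.1 rfl hv.1 (hvj.trans hui.symm) hn).append_right _
    have hij' : (i : ℕ) ≠ j := fun h ↦ hij (Fin.ext h)
    by_cases hadj : (i : ℕ) + 1 = j
    · have e : i.succ = j.castSucc := Fin.ext hadj
      exact absurd ⟨i.castSucc, i.succ, j.succ, by simp, by simp [e], e ▸ hdj, hdi⟩ h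
    by_cases hadj' : (j : ℕ) + 1 = i
    · have e : j.succ = i.castSucc := Fin.ext hadj'
      exact absurd ⟨j.castSucc, j.succ, i.succ, by simp, by simp [e], e ▸ hdi, hdj⟩ h
    obtain ⟨x, hx, hx'⟩ := (cs m).exists_isReduced (w * (cs m).simple i * (cs m).simple j)
    have sw : ∀ {k l : Fin m}, (k : ℕ) + 2 ≤ l ∨ (l : ℕ) + 2 ≤ k →
        adjSwap k l.castSucc = l.castSucc ∧ adjSwap k l.succ = l.succ := fun hkl ↦
      ⟨swap_apply_of_ne_of_ne (by simp [Fin.ext_iff]; omega) (by simp [Fin.ext_iff]; omega),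
        swap_apply_of_ne_of_ne (by simp [Fin.ext_iff]; omega) (by simp [Fin.ext_iff]; omega)⟩
    have h1 := exists_isReduced_append_of_descent (w := w * (cs m).simple i) (i := j) (by
      rw [map_mul, toPerm_simple, Perm.mul_apply, Perm.mul_apply, (sw (by omega)).1,
        (sw (by omega)).2]
      exact hdj) hx hx'.symm
    have h2 := exists_isReduced_append_of_descent (w := w * (cs m).simple j) (i := i) (by
      rw [map_mul, toPerm_simple, Perm.mul_apply, Perm.mul_apply, (sw (by omega)).1,
        (sw (by omega)).2]
      exact hdi) hx (by rw [← hx', mul_assoc, mul_assoc, simple_comm i j (by omega)])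
    have e1 := (ih h3i hu.1 rfl h1.1 (h1.2.trans hui.symm) hn).append_right [i]
    have e2 := (ih h3j hv.1 rfl h2.1 (h2.2.trans hvj.symm) (hl ▸ hn)).append_right [j]
    refine e1.trans _ _ _ (.trans _ _ _ (.rel _ _ ?_) e2.symm)
    refine ⟨x, [], j, i, ?_, by simp, by simp⟩
    rw [typeA_apply, if_neg (by omega), if_neg (by omega)]

theorem isFCInvolution_iff (w : (typeA m).Group) :
    IsFCInvolution (typeA m).toCoxeterSystem w ↔
      ¬ Has321 (toPerm m w) ∧ toPerm m w * toPerm m w = 1 := by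
  refine and_congr ⟨fun h h3 ↦ not_isFullyCommutative_of_has321 h3 h,
    fun h u v hu hu' hv hv' ↦ commEquiv_of_not_has321 h hu hu' hv hv'⟩ ?_
  rw [← map_mul, ← (toPerm m).map_one, toPerm_injective.eq_iff]

end TypeA

/-- The number of fully commutative involutions in the Coxeter group of type `A_{n-1}`
equals the binomial coefficient `C(n, ⌊n/2⌋)`. -/
theorem card_fcInvolutions_typeA (n : ℕ) (hn : 1 ≤ n) :
    Nat.card {w : (typeA (n - 1)).Group //
        IsFCInvolution (typeA (n - 1)).toCoxeterSystem w} =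
      Nat.choose n (n / 2) := by
  obtain ⟨m, rfl⟩ : ∃ m, n = m + 1 := ⟨n - 1, by omega⟩
  rw [← TypeA.card_involutions_not_has321]
  exact Nat.card_congr ((Equiv.ofBijective _
    ⟨TypeA.toPerm_injective, TypeA.toPerm_surjective⟩).subtypeEquiv TypeA.isFCInvolution_iff)
end

section
/- For every integer n ≥ 1, the number of fully commutative involutions in the Coxeter group of type B_n equals 2^n + C(n, ⌊n/2⌋) − 1. -/
open CoxeterSystem

/-- The Coxeter matrix of type `B_n`: generators `s_1, …, s_n` (index `k : Fin n`
corresponds to `s_{k+1}`), with `m(s_i, s_{i+1}) = 3` for `1 ≤ i ≤ n-2`,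
`m(s_{n-1}, s_n) = 4`, and `m(s_i, s_j) = 2` for non-adjacent pairs. -/
def typeB (n : ℕ) : CoxeterMatrix (Fin n) where
  M := Matrix.of fun i j : Fin n =>
    if (i : ℕ) = (j : ℕ) then 1
    else if (i : ℕ) + 1 = (j : ℕ) ∨ (j : ℕ) + 1 = (i : ℕ) then
      (if (i : ℕ) + 1 = n ∨ (j : ℕ) + 1 = n then 4 else 3)
    else 2
  isSymm := by
    ext i j
    simp only [Matrix.transpose_apply, Matrix.of_apply]
    split_ifs <;> omega
  diagonal := by intro i; simp [Matrix.of_apply]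
  off_diagonal := by
    intro i j hij
    have h : (i : ℕ) ≠ (j : ℕ) := fun h => hij (Fin.ext h)
    simp only [Matrix.of_apply]
    split_ifs <;> omega

section Exchange

variable {B W : Type*} [Group W] {M : CoxeterMatrix B} (cs : CoxeterSystem M W)

open Classical in
/-- The action of a generator on `W × ℤ/2` used to prove the exchange property. -/
noncomputable def exchangeStep (i : B) : Function.End (W × ZMod 2) :=
  fun p => (cs.simple i * p.1 * cs.simple i, p.2 + if p.1 = cs.simple i then 1 else 0)

open Classical in
theorem prod_exchangeStep (ω : List B) (p : W × ZMod 2) :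
    (ω.map (exchangeStep cs)).prod p =
      (cs.wordProd ω * p.1 * (cs.wordProd ω)⁻¹, p.2 + ((cs.rightInvSeq ω).count p.1 : ZMod 2)) := by
  induction ω with
  | nil => simp [Function.End.one_def]
  | cons i ω ih =>
    have e : ((i :: ω).map (exchangeStep cs)).prod p =
        exchangeStep cs i ((ω.map (exchangeStep cs)).prod p) := by
      rw [List.map_cons, List.prod_cons]; rfl
    rw [e, ih]
    have h : cs.wordProd ω * p.1 * (cs.wordProd ω)⁻¹ = cs.simple i ↔
        (cs.wordProd ω)⁻¹ * cs.simple i * cs.wordProd ω = p.1 := by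
      constructor
      · intro h; rw [← h]; group
      · intro h; rw [← h]; group
    simp only [exchangeStep, h, rightInvSeq, List.count_cons, beq_iff_eq, wordProd_cons, mul_inv_rev,
      inv_simple, Prod.mk.injEq]
    refine ⟨by group, ?_⟩
    split_ifs <;> push_cast <;> ring

theorem leftInvSeq_alternatingWord_two_mul (i j : B) :
    cs.leftInvSeq (alternatingWord i j (2 * M i j)) =
      (cs.leftInvSeq (alternatingWord i j (2 * M i j))).take (M i j) ++
      (cs.leftInvSeq (alternatingWord i j (2 * M i j))).take (M i j) := by
  conv_lhs => rw [← List.take_append_drop (M i j)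
    (cs.leftInvSeq (alternatingWord i j (2 * M i j)))]
  congr 1
  apply List.ext_getElem
  · simp; omega
  · intro k h1 h2
    have hk : k < M i j := by simp at h2; omega
    rw [List.getElem_drop, List.getElem_take,
      getElem_leftInvSeq_alternatingWord cs i j _ _ (by omega),
      getElem_leftInvSeq_alternatingWord cs i j _ _ (by omega),
      prod_alternatingWord_eq_mul_pow, prod_alternatingWord_eq_mul_pow]
    have e1 : (2 * (M i j + k) + 1) / 2 = M i j + k := by omega
    have e2 : (2 * k + 1) / 2 = k := by omega
    rw [e1, e2, pow_add, M.symmetric i j, simple_mul_simple_pow]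
    simp

theorem prod_map_alternatingWord_two_mul {G : Type*} [Monoid G] (f : B → G) (i j : B) (k : ℕ) :
    ((alternatingWord i j (2 * k)).map f).prod = (f i * f j) ^ k := by
  induction k with
  | zero => simp [alternatingWord]
  | succ k ih =>
    rw [show 2 * (k + 1) = 2 * k + 1 + 1 by ring, alternatingWord_succ, alternatingWord_succ]
    simp only [List.concat_eq_append, List.map_append, List.prod_append, List.map_cons,
      List.map_nil, List.prod_singleton, ih, pow_succ, mul_assoc]

theorem reverse_alternatingWord_two_mul (i j : B) (k : ℕ) :
    (alternatingWord i j (2 * k)).reverse = alternatingWord j i (2 * k) := by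
  apply List.ext_getElem
  · simp
  · intro p h1 h2
    simp at h2
    rw [List.getElem_reverse, getElem_alternatingWord _ _ _ _ (by simp; omega),
      getElem_alternatingWord _ _ _ _ (by omega)]
    simp only [length_alternatingWord]
    rcases Nat.even_or_odd p with hp | hp
    · have : ¬ Even (2 * k + (2 * k - 1 - p)) := by
        rw [Nat.not_even_iff_odd]; obtain ⟨r, rfl⟩ := hp; exact ⟨2 * k - 1 - r, by omega⟩
      have h' : Even (2 * k + p) := (even_two_mul k).add hp
      simp [this, h']
    · have : Even (2 * k + (2 * k - 1 - p)) := by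
        obtain ⟨r, rfl⟩ := hp; exact ⟨2 * k - 1 - r, by omega⟩
      have h' : ¬ Even (2 * k + p) := by
        rw [Nat.not_even_iff_odd]; exact (even_two_mul k).add_odd hp
      simp [this, h']

theorem isLiftable_exchangeStep : M.IsLiftable (exchangeStep cs) := by
  classical
  intro i j
  rw [← prod_map_alternatingWord_two_mul]
  funext p
  rw [prod_exchangeStep, ← reverse_alternatingWord_two_mul, rightInvSeq_reverse, M.symmetric i j,
    leftInvSeq_alternatingWord_two_mul, List.count_reverse, List.count_append,
    reverse_alternatingWord_two_mul, prod_alternatingWord_eq_mul_pow]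
  have h2 : 2 * M j i / 2 = M j i := by omega
  rw [h2, M.symmetric j i, simple_mul_simple_pow]
  have h3 (x : ZMod 2) : x + x = 0 := CharTwo.add_self_eq_zero x
  simp [Function.End.one_def, h3]

open Classical in
theorem count_leftInvSeq_eq {u v : List B} (h : cs.wordProd u = cs.wordProd v) (t : W) :
    ((cs.leftInvSeq u).count t : ZMod 2) = (cs.leftInvSeq v).count t := by
  have key (ω : List B) : (cs.lift ⟨exchangeStep cs, isLiftable_exchangeStep cs⟩
      (cs.wordProd ω)⁻¹ (t, 0)).2 = ((cs.leftInvSeq ω).count t : ZMod 2) := by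
    rw [← wordProd_reverse, wordProd, map_list_prod, List.map_map]
    have : (cs.lift ⟨exchangeStep cs, isLiftable_exchangeStep cs⟩ ∘ cs.simple) = exchangeStep cs := by
      funext i
      simp
    rw [this, prod_exchangeStep, rightInvSeq_reverse, List.count_reverse]
    simp
  rw [← key u, ← key v, h]

/-- A word for `w` contains every left descent of `w` in its left inversion sequence. -/
theorem simple_mem_leftInvSeq {u : List B} {i : B}
    (h : cs.IsLeftDescent (cs.wordProd u) i) : cs.simple i ∈ cs.leftInvSeq u := by
  classical
  obtain ⟨v, hv, hvu⟩ := cs.exists_isReduced (cs.simple i * cs.wordProd u)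
  have huv : cs.wordProd u = cs.wordProd (i :: v) := by
    rw [wordProd_cons, ← hvu, simple_mul_simple_cancel_left]
  have hred : cs.IsReduced (i :: v) := by
    rw [isLeftDescent_iff] at h
    rw [CoxeterSystem.IsReduced, ← huv, List.length_cons, ← h, hvu, hv.eq]
  have h1 := List.count_eq_one_of_mem hred.nodup_leftInvSeq
    (show cs.simple i ∈ cs.leftInvSeq (i :: v) by simp [leftInvSeq])
  have h2 := count_leftInvSeq_eq cs huv (cs.simple i)
  rw [h1] at h2
  by_contra hn
  rw [List.count_eq_zero_of_not_mem hn] at h2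
  exact absurd h2 (by simp)

end Exchange

section Commutation

variable {B : Type*} {M : CoxeterMatrix B}

theorem CommEquiv.refl (u : List B) : CommEquiv M u u := Relation.EqvGen.refl u

theorem CommEquiv.symm {u v : List B} (h : CommEquiv M u v) : CommEquiv M v u :=
  Relation.EqvGen.symm _ _ h

theorem CommEquiv.trans {u v w : List B} (h : CommEquiv M u v) (h' : CommEquiv M v w) :
    CommEquiv M u w :=
  Relation.EqvGen.trans _ _ _ h h'

theorem CommEquiv.cons {u v : List B} (s : B) (h : CommEquiv M u v) :
    CommEquiv M (s :: u) (s :: v) := by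
  induction h with
  | rel u v h =>
    obtain ⟨x, y, a, b, hab, rfl, rfl⟩ := h
    exact Relation.EqvGen.rel _ _ ⟨s :: x, y, a, b, hab, rfl, rfl⟩
  | refl u => exact .refl _
  | symm _ _ _ ih => exact ih.symm
  | trans _ _ _ _ _ ih ih' => exact ih.trans ih'

theorem CommEquiv.swap {s t : B} (h : M s t = 2) (u : List B) :
    CommEquiv M (s :: t :: u) (t :: s :: u) :=
  Relation.EqvGen.rel _ _ ⟨[], u, s, t, h, rfl, rfl⟩

theorem CommEquiv.length_eq {u v : List B} (h : CommEquiv M u v) : u.length = v.length := by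
  induction h with
  | rel u v h =>
    obtain ⟨x, y, a, b, hab, rfl, rfl⟩ := h
    simp
  | refl u => rfl
  | symm _ _ _ ih => exact ih.symm
  | trans _ _ _ _ _ ih ih' => exact ih.trans ih'

theorem CommEquiv.wordProd_eq {W : Type*} [Group W] (cs : CoxeterSystem M W) {u v : List B}
    (h : CommEquiv M u v) : cs.wordProd u = cs.wordProd v := by
  induction h with
  | rel u v h =>
    obtain ⟨x, y, a, b, hab, rfl, rfl⟩ := h
    have h1 := cs.wordProd_braidWord_eq a b
    rw [braidWord, braidWord, M.symmetric b a, hab] at h1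
    simp only [alternatingWord, List.concat_eq_append, List.nil_append, List.cons_append,
      wordProd_cons, wordProd_nil, mul_one] at h1
    simp only [wordProd_append, wordProd_cons, ← mul_assoc]
    rw [mul_assoc _ (cs.simple a), mul_assoc _ (cs.simple b), h1]
  | refl u => rfl
  | symm _ _ _ ih => exact ih.symm
  | trans _ _ _ _ _ ih ih' => exact ih.trans ih'

theorem CommEquiv.cons_move {x : List B} {a : B} (h : ∀ b ∈ x, M a b = 2) (y : List B) :
    CommEquiv M (a :: (x ++ y)) (x ++ a :: y) := by
  induction x with
  | nil => exact .refl _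
  | cons b x ih =>
    simp only [List.mem_cons, forall_eq_or_imp] at h
    exact (CommEquiv.swap h.1 _).trans ((ih h.2).cons b)

variable [DecidableEq B]

theorem CommEquiv.filter_eq {u v : List B} (h : CommEquiv M u v) {a b : B} (hab : M a b ≠ 2) :
    u.filter (fun x => x = a ∨ x = b) = v.filter (fun x => x = a ∨ x = b) := by
  induction h with
  | rel u v h =>
    obtain ⟨x, y, c, d, hcd, rfl, rfl⟩ := h
    simp only [List.filter_append, List.filter_cons]
    have hcd' : M d c = 2 := by rw [M.symmetric]; exact hcd
    split_ifs with h1 h2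
    · simp only [decide_eq_true_eq] at h1 h2
      rcases h1 with rfl | rfl <;> rcases h2 with rfl | rfl
      · rfl
      · exact absurd hcd hab
      · exact absurd hcd' hab
      · rfl
    all_goals rfl
  | refl u => rfl
  | symm _ _ _ ih => exact ih.symm
  | trans _ _ _ _ _ ih ih' => exact ih.trans ih'

/-- Two words are commutation-equivalent as soon as they have the same projection to every pair
of non-commuting letters. -/
theorem CommEquiv.of_filter_eq {u v : List B}
    (h : ∀ a b, M a b ≠ 2 →
      u.filter (fun x => x = a ∨ x = b) = v.filter (fun x => x = a ∨ x = b)) :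
    CommEquiv M u v := by
  induction u generalizing v with
  | nil =>
    cases v with
    | nil => exact .refl _
    | cons b v =>
      have := h b b (by rw [M.diagonal]; norm_num)
      simp at this
  | cons a u ih =>
    have hav : a ∈ v := by
      have h1 := h a a (by rw [M.diagonal]; norm_num)
      have h2 : a ∈ (a :: u).filter (fun x => x = a ∨ x = a) := by simp
      rw [h1] at h2
      exact (List.mem_filter.1 h2).1
    obtain ⟨x, y, rfl, hax⟩ := List.eq_append_cons_of_mem hav
    have hx : ∀ b ∈ x, M a b = 2 := by
      intro b hb
      by_contra hab
      have h1 := h a b hab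
      rw [List.filter_cons_of_pos (by simp), List.filter_append] at h1
      cases hx : x.filter (fun x => x = a ∨ x = b) with
      | nil =>
        rw [List.filter_eq_nil_iff] at hx
        exact hx b hb (by simp)
      | cons c z =>
        rw [hx] at h1
        have hc : c ∈ x := by
          have : c ∈ x.filter (fun x => x = a ∨ x = b) := hx ▸ List.mem_cons_self
          exact (List.mem_filter.1 this).1
        simp only [List.cons_append, List.cons.injEq] at h1
        exact hax (h1.1 ▸ hc)
    refine CommEquiv.trans ((ih ?_).cons a) (CommEquiv.cons_move hx y)
    intro c d hcd
    have h1 := h c d hcd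
    rw [List.filter_append] at h1 ⊢
    by_cases hac : a = c ∨ a = d
    · have : x.filter (fun x => x = c ∨ x = d) = [] := by
        rw [List.filter_eq_nil_iff]
        intro b hb
        simp only [decide_eq_true_eq]
        rintro (rfl | rfl)
        · rcases hac with rfl | rfl
          · exact hax hb
          · exact hcd (by rw [M.symmetric]; exact hx _ hb)
        · rcases hac with rfl | rfl
          · exact hcd (hx _ hb)
          · exact hax hb
      rw [this] at h1 ⊢
      simpa [hac] using h1
    · simpa [hac] using h1

end Commutation

section FullyCommutativeWords

variable {B W : Type*} [Group W] {M : CoxeterMatrix B}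

/-- A word is fully commutative if no word in its commutation class contains a repeated letter
or a braid word of length at least three. -/
def IsFCWord (M : CoxeterMatrix B) (u : List B) : Prop :=
  ∀ v, CommEquiv M u v → (∀ s, ¬ [s, s] <:+: v) ∧
    ∀ s t, s ≠ t → 3 ≤ M s t → ¬ alternatingWord s t (M s t) <:+: v

theorem IsFCWord.of_equiv {u v : List B} (h : IsFCWord M u) (huv : CommEquiv M u v) :
    IsFCWord M v := fun w hw => h w (huv.trans hw)

theorem IsFCWord.of_cons {u : List B} {s : B} (h : IsFCWord M (s :: u)) : IsFCWord M u :=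
  fun v hv => ⟨fun t ht => (h _ (hv.cons s)).1 t (ht.trans (List.suffix_cons s v).isInfix),
    fun a b hab hm ht => (h _ (hv.cons s)).2 a b hab hm (ht.trans (List.suffix_cons s v).isInfix)⟩

variable (cs : CoxeterSystem M W)

theorem isLeftDescent_cons {u : List B} {s : B} (h : cs.IsReduced (s :: u)) :
    cs.IsLeftDescent (cs.wordProd (s :: u)) s := by
  have h' := cs.length_wordProd_le u
  rw [IsLeftDescent, h.eq, wordProd_cons, simple_mul_simple_cancel_left, List.length_cons]
  omega

theorem simple_not_mem_leftInvSeq_alternatingWord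
    (hord : ∀ s t : B, s ≠ t → ∀ q, 0 < q → q < M s t → (cs.simple s * cs.simple t) ^ q ≠ 1)
    {a b : B} (hab : a ≠ b) {k : ℕ} (hk : k < M a b) :
    cs.simple b ∉ cs.leftInvSeq ((alternatingWord a b (2 * M a b)).take k) := by
  intro h
  rw [leftInvSeq_take, List.mem_take_iff_getElem] at h
  obtain ⟨p, hp, he⟩ := h
  simp only [length_leftInvSeq, length_alternatingWord, lt_min_iff] at hp
  rw [getElem_leftInvSeq_alternatingWord cs a b _ _ hp.2, prod_alternatingWord_eq_mul_pow] at he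
  have e1 : (2 * p + 1) / 2 = p := by omega
  rw [e1] at he
  have hne : ¬ Even (2 * p + 1) := by simp
  rw [if_neg hne] at he
  apply hord b a hab.symm (p + 1) (by omega) (by rw [M.symmetric]; omega)
  rw [pow_succ', mul_assoc, he, simple_mul_simple_self]

theorem exists_alternatingWord_append
    (hord : ∀ s t : B, s ≠ t → ∀ q, 0 < q → q < M s t → (cs.simple s * cs.simple t) ^ q ≠ 1)
    {w : W} {m : ℕ} (k : ℕ) (hk : k ≤ m) {a b : B} (hab : a ≠ b) (hm : M a b = m)
    (ha : cs.IsLeftDescent w a) (hb : cs.IsLeftDescent w b) :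
    ∃ c, cs.IsReduced ((alternatingWord a b (2 * m)).take k ++ c) ∧
      cs.wordProd ((alternatingWord a b (2 * m)).take k ++ c) = w := by
  induction k generalizing a b with
  | zero =>
    obtain ⟨c, hc, h⟩ := cs.exists_isReduced w
    exact ⟨c, by simpa using hc, by simpa using h.symm⟩
  | succ k ih =>
    obtain ⟨c, hc, h⟩ := ih (by omega) hab.symm (by rw [M.symmetric]; exact hm) hb ha
    have hmem := simple_mem_leftInvSeq cs (h.symm ▸ ha)
    obtain ⟨p, hp, he⟩ := List.getElem_of_mem hmem
    have hdel := cs.getD_leftInvSeq_mul_wordProd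
      ((alternatingWord b a (2 * m)).take k ++ c) p
    rw [List.getD_eq_getElem _ _ hp, he, h] at hdel
    have hlen : ((alternatingWord b a (2 * m)).take k).length = k := by simp; omega
    rw [length_leftInvSeq, List.length_append, hlen] at hp
    rw [listTake_succ_alternatingWord _ _ _ _ (by omega)]
    by_cases hpk : p < k
    · exfalso
      refine simple_not_mem_leftInvSeq_alternatingWord cs hord hab.symm (k := k)
        (by rw [M.symmetric, hm]; omega) ?_
      rw [M.symmetric b a, hm]
      have h3 := cs.leftInvSeq_take ((alternatingWord b a (2 * m)).take k ++ c) k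
      rw [List.take_left' hlen] at h3
      rw [h3, ← he]
      exact List.mem_take_iff_getElem.2 ⟨p, by simp; omega, rfl⟩
    · rw [List.eraseIdx_append_of_length_le (by omega), hlen] at hdel
      have hw : cs.wordProd (a :: (alternatingWord b a (2 * m)).take k ++ c.eraseIdx (p - k)) = w := by
        rw [List.cons_append, wordProd_cons, ← hdel, simple_mul_simple_cancel_left]
      refine ⟨c.eraseIdx (p - k), ?_, hw⟩
      rw [CoxeterSystem.IsReduced, hw, ← h, hc.eq]
      simp only [List.length_append, List.length_cons, hlen, List.length_eraseIdx]
      rw [if_pos (by omega)]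
      omega

/-- A fully commutative word is reduced and commutation-equivalent to all reduced words
for the same element. -/
theorem IsFCWord.isReduced_and_commEquiv [DecidableEq B] (hM : ∀ s t, M s t ≠ 0)
    (hord : ∀ s t : B, s ≠ t → ∀ q, 0 < q → q < M s t → (cs.simple s * cs.simple t) ^ q ≠ 1)
    {a : List B} (ha : IsFCWord M a) :
    cs.IsReduced a ∧
      ∀ b, cs.IsReduced b → cs.wordProd b = cs.wordProd a → CommEquiv M a b := by
  induction hN : a.length generalizing a with
  | zero =>
    rw [List.length_eq_zero_iff] at hN
    subst hN
    have h0 : cs.IsReduced [] := by simp [CoxeterSystem.IsReduced]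
    refine ⟨h0, fun b hb hab => ?_⟩
    have : b.length = 0 := by rw [← hb.eq, hab, h0.eq]; rfl
    rw [List.length_eq_zero_iff] at this
    rw [this]
    exact .refl _
  | succ N ih =>
    obtain ⟨s, a, rfl⟩ := List.exists_cons_of_length_eq_add_one hN
    simp only [List.length_cons, Nat.add_right_cancel_iff] at hN
    obtain ⟨hr, he⟩ := ih ha.of_cons hN
    have hred : cs.IsReduced (s :: a) := by
      by_contra hn
      have hd : cs.IsLeftDescent (cs.wordProd a) s := by
        by_contra hd
        rw [not_isLeftDescent_iff, hr.eq] at hd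
        exact hn (by rw [CoxeterSystem.IsReduced, wordProd_cons, hd, List.length_cons])
      obtain ⟨c, hc, hw⟩ := cs.exists_isReduced (cs.simple s * cs.wordProd a)
      have hsc : cs.wordProd (s :: c) = cs.wordProd a := by
        rw [wordProd_cons, ← hw, simple_mul_simple_cancel_left]
      have hrc : cs.IsReduced (s :: c) := by
        rw [isLeftDescent_iff] at hd
        rw [CoxeterSystem.IsReduced, hsc, ← hd, hw, hc.eq, List.length_cons]
      exact (ha _ ((he _ hrc hsc).cons s)).1 s ⟨[], c, by simp⟩
    refine ⟨hred, fun b hb hab => ?_⟩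
    have hbl : b.length = N + 1 := by rw [← hb.eq, hab, hred.eq, List.length_cons, hN]
    obtain ⟨t, b, rfl⟩ := List.exists_cons_of_length_eq_add_one hbl
    have hrb : cs.IsReduced b := hb.drop 1
    by_cases hst : s = t
    · subst hst
      refine (he b hrb ?_).cons s
      rw [wordProd_cons, wordProd_cons] at hab
      exact mul_left_cancel hab
    · have hds := isLeftDescent_cons cs hred
      have hdt := isLeftDescent_cons cs hb
      rw [hab] at hdt
      obtain ⟨c, hc, hw⟩ := exists_alternatingWord_append cs hord (M s t) le_rfl hst rfl hds hdt
      have hm1 : M s t ≠ 1 := M.off_diagonal s t hst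
      have hm0 := hM s t
      obtain ⟨m, hm⟩ : ∃ m, M s t = m + 1 := ⟨M s t - 1, by omega⟩
      have hcons : (alternatingWord s t (2 * M s t)).take (M s t) =
          s :: (alternatingWord t s (2 * M s t)).take (M s t - 1) := by
        rw [← listTake_succ_alternatingWord _ _ _ _ (by omega)]
        congr 1
        omega
      have hrest : CommEquiv M (s :: a) ((alternatingWord s t (2 * M s t)).take (M s t) ++ c) := by
        rw [hcons, List.cons_append] at hc hw ⊢
        refine (he _ (hc.drop 1) ?_).cons s
        rw [wordProd_cons, wordProd_cons] at hw
        exact mul_left_cancel hw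
      by_cases hm3 : 3 ≤ M s t
      · exfalso
        rw [listTake_alternatingWord _ _ _ _ (by omega)] at hrest
        split_ifs at hrest
        · exact (ha _ hrest).2 s t hst hm3 ⟨[], c, by simp⟩
        · refine (ha _ hrest).2 t s (Ne.symm hst) (by rw [M.symmetric]; exact hm3) ⟨[], c, ?_⟩
          rw [M.symmetric t s, List.nil_append]
      · have hm2 : M s t = 2 := by omega
        have e : (alternatingWord s t (2 * M s t)).take (M s t) = [s, t] := by
          rw [hm2]; simp [alternatingWord]
        rw [e, List.cons_append, List.cons_append, List.nil_append] at hrest hw hc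
        have hrest' := hrest.trans (CommEquiv.swap hm2 c)
        have hFC := (ha.of_equiv hrest').of_cons
        have hlen : (s :: c).length = N := by
          have := hrest'.length_eq
          simp only [List.length_cons] at this ⊢
          omega
        refine hrest'.trans (((ih hFC hlen).2 b hrb ?_).cons t)
        have h1 := hrest'.wordProd_eq cs
        rw [← hab, wordProd_cons _ t, wordProd_cons _ t] at h1
        exact mul_left_cancel h1

theorem IsFullyCommutative.isFCWord [DecidableEq B] {w : W} (hw : IsFullyCommutative cs w)
    {u : List B} (hu : cs.IsReduced u) (huw : cs.wordProd u = w) : IsFCWord M u := by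
  intro v huv
  have hvw : cs.wordProd v = w := by rw [← huv.wordProd_eq cs, huw]
  have hv : cs.IsReduced v := by
    rw [CoxeterSystem.IsReduced, hvw, ← huw, hu.eq, huv.length_eq]
  refine ⟨?_, ?_⟩
  · rintro s ⟨x, y, rfl⟩
    have h1 : cs.wordProd (x ++ y) = w := by
      rw [← hvw]
      simp [wordProd_append, wordProd_cons]
    have h2 := cs.length_wordProd_le (x ++ y)
    rw [h1, ← hvw, hv.eq] at h2
    simp at h2
  · rintro s t hst hm ⟨x, y, rfl⟩
    have h1 : cs.wordProd (x ++ alternatingWord t s (M s t) ++ y) = w := by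
      rw [← hvw, wordProd_append, wordProd_append, wordProd_append, wordProd_append]
      have := cs.wordProd_braidWord_eq s t
      rw [braidWord, braidWord, M.symmetric t s] at this
      rw [this]
    have h2 : cs.IsReduced (x ++ alternatingWord t s (M s t) ++ y) := by
      rw [CoxeterSystem.IsReduced, h1, ← hvw, hv.eq]
      simp
    have h3 := (hw _ _ hv hvw h2 h1).filter_eq (a := s) (b := t) (by omega)
    simp only [List.filter_append, List.append_cancel_left_eq, List.append_cancel_right_eq] at h3
    have hall (i j : B) (h : ({i, j} : Set B) = {s, t}) (k : ℕ) :
        (alternatingWord i j k).filter (fun x => x = s ∨ x = t) = alternatingWord i j k := by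
      rw [List.filter_eq_self]
      intro c hc
      obtain ⟨p, hp, rfl⟩ := List.getElem_of_mem hc
      rw [length_alternatingWord] at hp
      rw [getElem_alternatingWord _ _ _ _ hp, decide_eq_true_eq]
      have : (if Even (k + p) then i else j) ∈ ({i, j} : Set B) := by split_ifs <;> simp
      rw [h] at this
      simpa using this
    rw [hall s t rfl, hall t s (Set.pair_comm t s)] at h3
    have h4 := congrArg List.head? h3
    obtain ⟨m, hm'⟩ : ∃ m, M s t = m + 1 := ⟨M s t - 1, by omega⟩
    rw [hm', alternatingWord_succ', alternatingWord_succ'] at h4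
    simp only [List.head?_cons, Option.some.injEq] at h4
    split_ifs at h4
    · exact hst h4.symm
    · exact hst h4

end FullyCommutativeWords

section SignedPermutations

/-- The signed permutation of `ℤ = {…, -2, -1} ∪ {0, 1, …}` exchanging `r - 1` with `r` and
`-r - 1` with `-r`; negation is `x ↦ -1 - x`. -/
def signedSwap (r x : ℤ) : ℤ :=
  if x = r then r - 1 else if x = r - 1 then r else if x = -r - 1 then -r
  else if x = -r then -r - 1 else x

theorem signedSwap_signedSwap (r x : ℤ) : signedSwap r (signedSwap r x) = x := by
  simp only [signedSwap]
  split_ifs <;> omega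

theorem signedSwap_of_ne {r x : ℤ} (h1 : x ≠ r) (h2 : x ≠ r - 1) (h3 : x ≠ -r - 1) (h4 : x ≠ -r) :
    signedSwap r x = x := by
  simp only [signedSwap, if_neg h1, if_neg h2, if_neg h3, if_neg h4]

theorem signedSwap_comm {r t : ℤ} (hr : 0 ≤ r) (h : r + 2 ≤ t) (x : ℤ) :
    signedSwap r (signedSwap t x) = signedSwap t (signedSwap r x) := by
  by_cases h1 : x = r ∨ x = r - 1 ∨ x = -r - 1 ∨ x = -r
  · have e1 : signedSwap t x = x := by simp only [signedSwap]; split_ifs <;> omega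
    have e2 : signedSwap t (signedSwap r x) = signedSwap r x := by
      rcases h1 with rfl | rfl | rfl | rfl <;> simp only [signedSwap] <;> split_ifs <;> omega
    rw [e1, e2]
  · simp only [not_or] at h1
    have e1 : signedSwap r x = x := by simp only [signedSwap]; split_ifs <;> omega
    have e2 : signedSwap r (signedSwap t x) = signedSwap t x := by
      have : signedSwap t x = t ∨ signedSwap t x = t - 1 ∨ signedSwap t x = -t ∨
          signedSwap t x = -t - 1 ∨ signedSwap t x = x := by
        simp only [signedSwap]; split_ifs <;> omega
      rcases this with h | h | h | h | h <;> rw [h] <;> simp only [signedSwap] <;>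
        split_ifs <;> omega
    rw [e1, e2]

theorem signedSwap_braid {r : ℤ} (h : 0 < r) (x : ℤ) :
    signedSwap r (signedSwap (r + 1) (signedSwap r x)) =
      signedSwap (r + 1) (signedSwap r (signedSwap (r + 1) x)) := by
  have a1 : signedSwap r (r - 1) = r := by simp only [signedSwap]; split_ifs <;> omega
  have a2 : signedSwap r r = r - 1 := by simp only [signedSwap]; split_ifs <;> omega
  have a3 : signedSwap r (r + 1) = r + 1 := by simp only [signedSwap]; split_ifs <;> omega
  have a4 : signedSwap r (-r) = -r - 1 := by simp only [signedSwap]; split_ifs <;> omega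
  have a5 : signedSwap r (-r - 1) = -r := by simp only [signedSwap]; split_ifs <;> omega
  have a6 : signedSwap r (-r - 2) = -r - 2 := by simp only [signedSwap]; split_ifs <;> omega
  have b1 : signedSwap (r + 1) (r - 1) = r - 1 := by simp only [signedSwap]; split_ifs <;> omega
  have b2 : signedSwap (r + 1) r = r + 1 := by simp only [signedSwap]; split_ifs <;> omega
  have b3 : signedSwap (r + 1) (r + 1) = r := by simp only [signedSwap]; split_ifs <;> omega
  have b4 : signedSwap (r + 1) (-r) = -r := by simp only [signedSwap]; split_ifs <;> omega
  have b5 : signedSwap (r + 1) (-r - 1) = -r - 2 := by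
    simp only [signedSwap]; split_ifs <;> omega
  have b6 : signedSwap (r + 1) (-r - 2) = -r - 1 := by
    simp only [signedSwap]; split_ifs <;> omega
  by_cases h1 : x = r - 1 ∨ x = r ∨ x = r + 1 ∨ x = -r - 2 ∨ x = -r - 1 ∨ x = -r
  · rcases h1 with rfl | rfl | rfl | rfl | rfl | rfl <;>
      simp only [a1, a2, a3, a4, a5, a6, b1, b2, b3, b4, b5, b6]
  · simp only [not_or] at h1
    clear a1 a2 a3 a4 a5 a6 b1 b2 b3 b4 b5 b6
    have e1 : signedSwap r x = x := by apply signedSwap_of_ne <;> omega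
    have e2 : signedSwap (r + 1) x = x := by apply signedSwap_of_ne <;> omega
    rw [e1, e2, e1, e2]

theorem signedSwap_braid_zero (x : ℤ) :
    signedSwap 0 (signedSwap 1 (signedSwap 0 (signedSwap 1 x))) =
      signedSwap 1 (signedSwap 0 (signedSwap 1 (signedSwap 0 x))) := by
  by_cases h1 : x = 0 ∨ x = 1 ∨ x = -1 ∨ x = -2
  · rcases h1 with rfl | rfl | rfl | rfl <;> simp [signedSwap]
  · simp only [not_or] at h1
    have e1 : signedSwap 0 x = x := by simp only [signedSwap]; split_ifs <;> omega
    have e2 : signedSwap 1 x = x := by simp only [signedSwap]; split_ifs <;> omega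
    rw [e1, e2, e1, e2, e1]

end SignedPermutations

section TypeB

variable {n : ℕ}

/-- The distance of a node of the Dynkin diagram of type `B_n` from the special end node `s_n`. -/
def typeBRank (i : Fin n) : ℕ := n - 1 - i

theorem typeBRank_injective : Function.Injective (typeBRank (n := n)) := by
  intro i j h
  simp only [typeBRank] at h
  ext
  omega

theorem typeBRank_lt (i : Fin n) : typeBRank i < n := by
  simp only [typeBRank]
  omega

theorem exists_typeBRank_eq {k : ℕ} (hk : k < n) : ∃ i : Fin n, typeBRank i = k :=
  ⟨⟨n - 1 - k, by omega⟩, by simp only [typeBRank]; omega⟩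

theorem typeB_apply (i j : Fin n) : typeB n i j =
    if typeBRank i = typeBRank j then 1
    else if typeBRank i + 1 = typeBRank j ∨ typeBRank j + 1 = typeBRank i then
      (if typeBRank i = 0 ∨ typeBRank j = 0 then 4 else 3)
    else 2 := by
  change (if (i : ℕ) = (j : ℕ) then 1
    else if (i : ℕ) + 1 = (j : ℕ) ∨ (j : ℕ) + 1 = (i : ℕ) then
      (if (i : ℕ) + 1 = n ∨ (j : ℕ) + 1 = n then 4 else 3)
    else 2) = _
  have h1 : n - 1 - (i : ℕ) = n - 1 - j ↔ (i : ℕ) = j := by omega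
  have h2 : (n - 1 - (i : ℕ) + 1 = n - 1 - j ∨ n - 1 - (j : ℕ) + 1 = n - 1 - i) ↔
      ((i : ℕ) + 1 = j ∨ (j : ℕ) + 1 = i) := by omega
  have h3 : (n - 1 - (i : ℕ) = 0 ∨ n - 1 - (j : ℕ) = 0) ↔ ((i : ℕ) + 1 = n ∨ (j : ℕ) + 1 = n) := by
    omega
  simp only [typeBRank, h1, h2, h3]

theorem typeB_ne_zero (i j : Fin n) : typeB n i j ≠ 0 := by
  rw [typeB_apply]
  split_ifs <;> norm_num

/-- The action of a generator of the Coxeter group of type `B_n` as a signed permutation. -/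
def typeBSwap (i : Fin n) : Function.End ℤ := fun x => signedSwap (typeBRank i) x

theorem typeBSwap_mul_self (i : Fin n) : typeBSwap i * typeBSwap i = 1 := by
  funext x
  exact signedSwap_signedSwap _ x

theorem typeBSwap_braid {i j : Fin n} (hi : 0 < typeBRank i)
    (hij : typeBRank i + 1 = typeBRank j) :
    typeBSwap i * typeBSwap j * typeBSwap i = typeBSwap j * typeBSwap i * typeBSwap j := by
  funext x
  have h := signedSwap_braid (r := typeBRank i) (by exact_mod_cast hi) x
  rw [show (typeBRank i : ℤ) + 1 = typeBRank j by exact_mod_cast hij] at h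
  exact h

theorem typeBSwap_comm {i j : Fin n} (hij : typeBRank i + 2 ≤ typeBRank j) :
    typeBSwap i * typeBSwap j = typeBSwap j * typeBSwap i := by
  funext x
  exact signedSwap_comm (r := typeBRank i) (t := typeBRank j) (by positivity)
    (by exact_mod_cast hij) x

theorem typeBSwap_braid_zero {i j : Fin n} (hi : typeBRank i = 0) (hj : typeBRank j = 1) :
    typeBSwap i * typeBSwap j * typeBSwap i * typeBSwap j =
      typeBSwap j * typeBSwap i * typeBSwap j * typeBSwap i := by
  funext x
  have h := signedSwap_braid_zero x
  have hi' : (typeBRank i : ℤ) = 0 := by exact_mod_cast hi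
  have hj' : (typeBRank j : ℤ) = 1 := by exact_mod_cast hj
  rw [← hi', ← hj'] at h
  exact h

theorem mul_pow_two_eq_one {G : Type*} [Monoid G] {a b : G} (ha : a * a = 1) (hb : b * b = 1)
    (h : a * b = b * a) : (a * b) ^ 2 = 1 := by
  rw [pow_two]
  nth_rw 2 [h]
  rw [mul_assoc, ← mul_assoc b, hb, one_mul, ha]

theorem mul_pow_three_eq_one {G : Type*} [Monoid G] {a b : G} (ha : a * a = 1) (hb : b * b = 1)
    (h : a * b * a = b * a * b) : (a * b) ^ 3 = 1 := by
  have : (a * b) ^ 3 = (a * b * a) * (b * a * b) := by simp only [pow_succ, pow_zero, one_mul, mul_assoc]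
  rw [this, ← h]
  calc a * b * a * (a * b * a) = a * (b * ((a * a) * b)) * a := by simp only [mul_assoc]
    _ = 1 := by rw [ha, one_mul, hb, mul_one, ha]

theorem mul_pow_four_eq_one {G : Type*} [Monoid G] {a b : G} (ha : a * a = 1) (hb : b * b = 1)
    (h : a * b * a * b = b * a * b * a) : (a * b) ^ 4 = 1 := by
  have : (a * b) ^ 4 = (a * b * a * b) * (a * b * a * b) := by
    simp only [pow_succ, pow_zero, one_mul, mul_assoc]
  rw [this]
  nth_rw 2 [h]
  calc a * b * a * b * (b * a * b * a) = a * (b * (a * (b * b) * a) * b) * a := by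
        simp only [mul_assoc]
    _ = 1 := by rw [hb, mul_one, ha, mul_one, hb, mul_one, ha]

theorem isLiftable_typeBSwap : (typeB n).IsLiftable typeBSwap := by
  intro i j
  have hi := typeBSwap_mul_self i
  have hj := typeBSwap_mul_self j
  rw [typeB_apply]
  split_ifs with h1 h2 h3
  · rw [typeBRank_injective h1, pow_one]
    exact hj
  · refine mul_pow_four_eq_one hi hj ?_
    rcases h2 with h2 | h2
    · exact typeBSwap_braid_zero (by omega) (by omega)
    · exact (typeBSwap_braid_zero (by omega) (by omega)).symm
  · refine mul_pow_three_eq_one hi hj ?_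
    rcases h2 with h2 | h2
    · exact typeBSwap_braid (by omega) h2
    · exact (typeBSwap_braid (by omega) h2).symm
  · refine mul_pow_two_eq_one hi hj ?_
    rcases Nat.lt_or_ge (typeBRank i) (typeBRank j) with h | h
    · exact typeBSwap_comm (by omega)
    · exact (typeBSwap_comm (by omega)).symm

theorem typeBSwap_mul_ne_one {i j : Fin n} (hij : i ≠ j) : typeBSwap i * typeBSwap j ≠ 1 := by
  intro h
  have heq (x : ℤ) : signedSwap (typeBRank i) x = signedSwap (typeBRank j) x := by
    have h1 := congrFun h (signedSwap (typeBRank j) x)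
    change signedSwap (typeBRank i) (signedSwap (typeBRank j) (signedSwap (typeBRank j) x)) =
      signedSwap (typeBRank j) x at h1
    rwa [signedSwap_signedSwap] at h1
  have hne : typeBRank i ≠ typeBRank j := fun h => hij (typeBRank_injective h)
  have h1 := heq (typeBRank i)
  have h2 := heq (typeBRank j)
  simp only [signedSwap] at h1 h2
  split_ifs at h1 h2 <;> omega

theorem typeB_simple_mul_simple_pow_ne_one (i j : Fin n) (hij : i ≠ j) (q : ℕ) (hq : 0 < q)
    (hqM : q < typeB n i j) :
    ((typeB n).toCoxeterSystem.simple i * (typeB n).toCoxeterSystem.simple j) ^ q ≠ 1 := by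
  intro h
  have hM := (typeB n).toCoxeterSystem.simple_mul_simple_pow i j
  have hne : (typeB n).toCoxeterSystem.simple i * (typeB n).toCoxeterSystem.simple j ≠ 1 := by
    intro h1
    apply typeBSwap_mul_ne_one hij
    have h2 := congrArg ((typeB n).toCoxeterSystem.lift ⟨typeBSwap, isLiftable_typeBSwap⟩) h1
    rw [map_mul, lift_apply_simple, lift_apply_simple, map_one] at h2
    exact h2
  generalize hg : (typeB n).toCoxeterSystem.simple i * (typeB n).toCoxeterSystem.simple j = g at *
  have hr : typeBRank i ≠ typeBRank j := fun h => hij (typeBRank_injective h)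
  rw [typeB_apply, if_neg hr] at hM hqM
  split_ifs at hM hqM with h2 h3
  · have hq' : q = 1 ∨ q = 2 ∨ q = 3 := by omega
    rcases hq' with rfl | rfl | rfl
    · exact hne (by simpa using h)
    · rw [← hg] at h
      have h4 := congrArg ((typeB n).toCoxeterSystem.lift ⟨typeBSwap, isLiftable_typeBSwap⟩) h
      rw [map_pow, map_mul, lift_apply_simple, lift_apply_simple, map_one] at h4
      have h5 := congrFun h4 0
      change signedSwap (typeBRank i) (signedSwap (typeBRank j)
        (signedSwap (typeBRank i) (signedSwap (typeBRank j) 0))) = 0 at h5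
      have h6 : (typeBRank i = 0 ∧ typeBRank j = 1) ∨ (typeBRank i = 1 ∧ typeBRank j = 0) := by
        omega
      rcases h6 with ⟨h6, h7⟩ | ⟨h6, h7⟩ <;> rw [h6, h7] at h5 <;> simp [signedSwap] at h5
    · rw [show 4 = 3 + 1 from rfl, pow_succ, h, one_mul] at hM
      exact hne hM
  · have hq' : q = 1 ∨ q = 2 := by omega
    rcases hq' with rfl | rfl
    · exact hne (by simpa using h)
    · rw [show 3 = 2 + 1 from rfl, pow_succ, h, one_mul] at hM
      exact hne hM
  · have hq' : q = 1 := by omega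
    subst hq'
    exact hne (by simpa using h)

end TypeB

section NatWords

/-- The subword of `u` formed by the letters `k` and `k + 1`. -/
def edgeProj (k : ℕ) (u : List ℕ) : List ℕ := u.filter fun x => x = k ∨ x = k + 1

theorem edgeProj_append (k : ℕ) (u v : List ℕ) :
    edgeProj k (u ++ v) = edgeProj k u ++ edgeProj k v := List.filter_append ..

theorem edgeProj_reverse (k : ℕ) (u : List ℕ) :
    edgeProj k u.reverse = (edgeProj k u).reverse := List.filter_reverse ..

theorem edgeProj_cons (k i : ℕ) (u : List ℕ) :
    edgeProj k (i :: u) = if i = k ∨ i = k + 1 then i :: edgeProj k u else edgeProj k u := by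
  simp [edgeProj, List.filter_cons]

theorem edgeProj_nil (k : ℕ) : edgeProj k [] = [] := rfl

theorem mem_edgeProj {k x : ℕ} {u : List ℕ} : x ∈ edgeProj k u ↔ x ∈ u ∧ (x = k ∨ x = k + 1) := by
  simp [edgeProj]

theorem edgeProj_eq_nil {k : ℕ} {u : List ℕ} : edgeProj k u = [] ↔ k ∉ u ∧ k + 1 ∉ u := by
  simp only [List.eq_nil_iff_forall_not_mem, mem_edgeProj]
  grind

theorem List.IsInfix.edgeProj {u v : List ℕ} (h : u <:+: v) (k : ℕ) :
    _root_.edgeProj k u <:+: _root_.edgeProj k v := h.filter _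

/-- Equality of all projections to pairs of consecutive letters. -/
def ProjEq (u v : List ℕ) : Prop := ∀ k, edgeProj k u = edgeProj k v

/-- The combinatorial criterion for full commutativity in type `B`, for words in the ranks. -/
def IsFCNatWord (u : List ℕ) : Prop :=
  ∀ v, ProjEq u v → (∀ i, ¬ [i, i] <:+: v) ∧
    (∀ i, 1 ≤ i → ¬ [i, i + 1, i] <:+: v ∧ ¬ [i + 1, i, i + 1] <:+: v) ∧
    ¬ [0, 1, 0, 1] <:+: v ∧ ¬ [1, 0, 1, 0] <:+: v

theorem infix_reverse_comm {u v : List ℕ} : u <:+: v.reverse ↔ u.reverse <:+: v := by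
  rw [← List.reverse_infix, List.reverse_reverse]

theorem IsFCNatWord.reverse {u : List ℕ} (h : IsFCNatWord u) : IsFCNatWord u.reverse := by
  intro v hv
  have h' := h v.reverse fun k => by
    rw [edgeProj_reverse, ← hv k, edgeProj_reverse, List.reverse_reverse]
  simp only [infix_reverse_comm, List.reverse_cons, List.reverse_nil, List.nil_append,
    List.cons_append] at h'
  exact ⟨h'.1, h'.2.1, h'.2.2.2, h'.2.2.1⟩

theorem edgeProj_move {k i : ℕ} {y : List ℕ} (h : ∀ b ∈ y, b + 1 ≠ i ∧ b ≠ i ∧ b ≠ i + 1) :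
    edgeProj k (i :: y) = edgeProj k (y ++ [i]) := by
  simp only [edgeProj_append, edgeProj_cons, edgeProj_nil]
  split_ifs with hk
  · have : edgeProj k y = [] := by
      rw [edgeProj_eq_nil]
      constructor <;> intro hb <;> have := h _ hb <;> omega
    simp [this]
  · simp

theorem IsFCNatWord.not_pair {u : List ℕ} (hu : IsFCNatWord u) {i : ℕ} {x y z : List ℕ}
    (hy : ∀ b ∈ y, b + 1 ≠ i ∧ b ≠ i ∧ b ≠ i + 1) : u ≠ x ++ i :: (y ++ i :: z) := by
  rintro rfl
  refine (hu (x ++ y ++ [i, i] ++ z) fun k => ?_).1 i ⟨x ++ y, z, rfl⟩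
  rw [show x ++ i :: (y ++ i :: z) = x ++ ((i :: y) ++ i :: z) by simp,
    edgeProj_append, edgeProj_append, edgeProj_move hy]
  simp only [edgeProj_append, edgeProj_cons, edgeProj_nil]
  split_ifs <;> simp

theorem IsFCNatWord.not_triple {u : List ℕ} (hu : IsFCNatWord u) {i j : ℕ} {x y y' z : List ℕ}
    (hy : ∀ b ∈ y, b + 1 ≠ i ∧ b ≠ i ∧ b ≠ i + 1) (hy' : ∀ b ∈ y', b + 1 ≠ i ∧ b ≠ i ∧ b ≠ i + 1)
    (hi : 1 ≤ i) (hj : j = i + 1 ∨ (j + 1 = i ∧ 1 ≤ j)) :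
    u ≠ x ++ i :: (y ++ j :: (y' ++ i :: z)) := by
  rintro rfl
  have key : ¬ [i, j, i] <:+: (x ++ y ++ [i, j, i] ++ (y' ++ z)) := by
    have := (hu (x ++ y ++ [i, j, i] ++ (y' ++ z)) fun k => ?_).2.1
    · rcases hj with rfl | ⟨rfl, hj⟩
      · exact (this i hi).1
      · exact (this j hj).2
    · rw [show x ++ i :: (y ++ j :: (y' ++ i :: z)) = x ++ ((i :: y) ++ (j :: ((y' ++ [i]) ++ z)))
        by simp, edgeProj_append, edgeProj_append, edgeProj_move hy, edgeProj_cons,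
        edgeProj_append k (y' ++ [i]), ← edgeProj_move hy']
      simp only [edgeProj_append, edgeProj_cons, edgeProj_nil]
      split_ifs <;> simp
  exact key ⟨x ++ y, y' ++ z, rfl⟩

theorem IsFCNatWord.not_quadruple {u : List ℕ} (hu : IsFCNatWord u) {x y z t w : List ℕ}
    (hy : ∀ b ∈ y, b ≠ 0 ∧ b ≠ 1 ∧ b ≠ 2) (hz : ∀ b ∈ z, b ≠ 0 ∧ b ≠ 1 ∧ b ≠ 2)
    (ht : ∀ b ∈ t, b ≠ 0 ∧ b ≠ 1) :
    u ≠ x ++ 1 :: (y ++ 0 :: (z ++ 1 :: (t ++ 0 :: w))) := by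
  rintro rfl
  refine (hu (x ++ y ++ [1, 0, 1, 0] ++ (z ++ t ++ w)) fun k => ?_).2.2.2
    ⟨x ++ y, z ++ t ++ w, rfl⟩
  by_cases h0 : k = 0
  · have h1 : edgeProj k y = [] := by grind [edgeProj_eq_nil]
    have h2 : edgeProj k z = [] := by grind [edgeProj_eq_nil]
    have h3 : edgeProj k t = [] := by grind [edgeProj_eq_nil]
    subst h0
    simp [edgeProj_append, edgeProj_cons, h1, h2, h3]
  by_cases hk : k = 1
  · have h1 : edgeProj k y = [] := by grind [edgeProj_eq_nil]
    have h2 : edgeProj k z = [] := by grind [edgeProj_eq_nil]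
    subst hk
    simp [edgeProj_append, edgeProj_cons, h1, h2]
  · have h2 : ¬ (0 = k ∨ 0 = k + 1) := by omega
    have h3 : ¬ (1 = k ∨ 1 = k + 1) := by omega
    simp only [edgeProj_append, edgeProj_cons, edgeProj_nil, if_neg h2, if_neg h3,
      List.append_assoc, List.nil_append]

/-- A repeated letter in a projection comes from two occurrences of it in the word. -/
theorem exists_of_pair_infix_edgeProj {u : List ℕ} {k i : ℕ} (h : [i, i] <:+: edgeProj k u) :
    ∃ x y z, u = x ++ i :: (y ++ i :: z) ∧ edgeProj k y = [] := by
  obtain ⟨s, t, h⟩ := h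
  rw [List.append_assoc, eq_comm, edgeProj, List.filter_eq_append_iff] at h
  obtain ⟨l1, l2, rfl, -, h⟩ := h
  rw [List.cons_append, List.filter_eq_cons_iff] at h
  obtain ⟨l3, l4, rfl, -, -, h⟩ := h
  rw [List.cons_append, List.filter_eq_cons_iff] at h
  obtain ⟨l5, l6, rfl, h5, -, h⟩ := h
  refine ⟨l1 ++ l3, l5, l6, by simp, ?_⟩
  rw [edgeProj, List.filter_eq_nil_iff]
  exact h5

/-- If `y` has at most one letter `j` the rest not being neighbours, `i y i` violates full
commutativity; hence `j` occurs twice. -/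
theorem IsFCNatWord.two_le_count {u : List ℕ} (hu : IsFCNatWord u) {i j : ℕ} {x y z : List ℕ}
    (h : u = x ++ i :: (y ++ i :: z)) (hi : 1 ≤ i) (hj : j = i + 1 ∨ (j + 1 = i ∧ 1 ≤ j))
    (hy : ∀ b ∈ y, b ≠ j → b + 1 ≠ i ∧ b ≠ i ∧ b ≠ i + 1) : 2 ≤ y.count j := by
  by_contra hc
  by_cases hm : j ∈ y
  · obtain ⟨y1, y2, rfl⟩ := List.append_of_mem hm
    have hc' : y1.count j = 0 ∧ y2.count j = 0 := by
      simp only [List.count_append, List.count_cons_self] at hc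
      omega
    rw [List.count_eq_zero, List.count_eq_zero] at hc'
    refine hu.not_triple (x := x) (y := y1) (y' := y2) (z := z) (fun b hb => hy b (by simp [hb]) ?_)
      (fun b hb => hy b (by simp [hb]) ?_) hi hj (by simpa using h)
    · rintro rfl
      exact hc'.1 hb
    · rintro rfl
      exact hc'.2 hb
  · refine hu.not_pair (fun b hb => hy b hb ?_) h
    rintro rfl
    exact hm hb

theorem eq_replicate_edgeProj {y : List ℕ} {k j : ℕ} (hj : j = k ∨ j = k + 1)
    (h : ∀ b ∈ y, b = k ∨ b = k + 1 → b = j) : edgeProj k y = List.replicate (y.count j) j := by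
  rw [List.eq_replicate_iff]
  constructor
  · rw [edgeProj, List.count, ← List.countP_eq_length_filter]
    refine List.countP_congr fun b hb => ?_
    have := h b hb
    simp
    grind
  · intro b hb
    rw [mem_edgeProj] at hb
    exact h b hb.1 hb.2

theorem pair_infix_replicate {m i : ℕ} (h : 2 ≤ m) : [i, i] <:+: List.replicate m i := by
  obtain ⟨m, rfl⟩ := Nat.exists_eq_add_of_le h
  refine ⟨[], List.replicate m i, ?_⟩
  rw [List.replicate_add]
  rfl

theorem IsFCNatWord.not_succ_pair {u : List ℕ} (hu : IsFCNatWord u) (i : ℕ) :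
    ¬ [i + 1, i + 1] <:+: edgeProj i u := by
  intro h
  have hstep (m : ℕ) (h : [m + 1, m + 1] <:+: edgeProj m u) :
      [m + 2, m + 2] <:+: edgeProj (m + 1) u := by
    obtain ⟨x, y, z, rfl, hy⟩ := exists_of_pair_infix_edgeProj h
    rw [edgeProj_eq_nil] at hy
    have h2 := hu.two_le_count (j := m + 2) rfl (by omega) (by omega) fun b hb hbj => by
      have h1 : b ≠ m := fun h => hy.1 (h ▸ hb)
      have h2 : b ≠ m + 1 := fun h => hy.2 (h ▸ hb)
      omega
    refine (pair_infix_replicate h2).trans ?_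
    rw [← eq_replicate_edgeProj (k := m + 1) (by omega)]
    · refine List.IsInfix.edgeProj ⟨x ++ [m + 1], (m + 1) :: z, by simp⟩ _
    · rintro b hb (rfl | rfl)
      · exact absurd hb hy.2
      · rfl
  have hall (m : ℕ) : [i + m + 1, i + m + 1] <:+: edgeProj (i + m) u := by
    induction m with
    | zero => exact h
    | succ m ih => exact hstep _ ih
  have hmem (m : ℕ) : i + m + 1 ∈ u := by
    have := (hall m).subset (List.mem_cons_self (a := i + m + 1))
    exact (mem_edgeProj.1 this).1
  have hle : i + u.sum + 1 ≤ u.sum := List.le_sum_of_mem (hmem u.sum)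
  omega

theorem IsFCNatWord.not_zero_pair {u : List ℕ} (hu : IsFCNatWord u) :
    ¬ [0, 0] <:+: edgeProj 0 u := by
  intro h
  obtain ⟨x, y, z, rfl, hy⟩ := exists_of_pair_infix_edgeProj h
  rw [edgeProj_eq_nil] at hy
  refine hu.not_pair (i := 0) (fun b hb => ⟨by omega, ?_, ?_⟩) rfl
  · rintro rfl
    exact hy.1 hb
  · rintro rfl
    exact hy.2 hb

/-- A gap at `i + 2` forces a gap at `i + 1`, and determines the projection if the letter `i + 1`
occurs only twice. -/
theorem IsFCNatWord.gap_step {u : List ℕ} (hu : IsFCNatWord u) {i : ℕ}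
    (h : [i + 2, i + 2] <:+: edgeProj (i + 2) u) :
    [i + 1, i + 1] <:+: edgeProj (i + 1) u ∧
      (u.count (i + 1) ≤ 2 → edgeProj (i + 1) u = [i + 2, i + 1, i + 1, i + 2]) := by
  obtain ⟨x, y, z, rfl, hy⟩ := exists_of_pair_infix_edgeProj h
  rw [edgeProj_eq_nil] at hy
  have h2 := hu.two_le_count (j := i + 1) rfl (by omega) (by omega) fun b hb hbj => by
    have h1 : b ≠ i + 2 := fun h => hy.1 (h ▸ hb)
    have h2 : b ≠ i + 2 + 1 := fun h => hy.2 (h ▸ hb)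
    omega
  have hyr : edgeProj (i + 1) y = List.replicate (y.count (i + 1)) (i + 1) := by
    refine eq_replicate_edgeProj (by omega) ?_
    rintro b hb (rfl | rfl)
    · rfl
    · exact absurd hb hy.1
  constructor
  · refine (pair_infix_replicate h2).trans ?_
    rw [← hyr]
    exact List.IsInfix.edgeProj ⟨x ++ [i + 2], (i + 2) :: z, by simp⟩ _
  · intro hc
    have hD := hu.not_succ_pair (i + 1)
    simp only [List.count_append, List.count_cons] at hc
    have hx0 : x.count (i + 1) = 0 := by omega
    have hz0 : z.count (i + 1) = 0 := by omega
    have hy2 : y.count (i + 1) = 2 := by omega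
    rw [List.count_eq_zero] at hx0 hz0
    have hxr : edgeProj (i + 1) x = List.replicate (x.count (i + 2)) (i + 2) := by
      refine eq_replicate_edgeProj (by omega) ?_
      rintro b hb (rfl | rfl)
      · exact absurd hb hx0
      · rfl
    have hzr : edgeProj (i + 1) z = List.replicate (z.count (i + 2)) (i + 2) := by
      refine eq_replicate_edgeProj (by omega) ?_
      rintro b hb (rfl | rfl)
      · exact absurd hb hz0
      · rfl
    rw [hy2] at hyr
    simp only [edgeProj_append, edgeProj_cons, hxr, hyr, hzr] at hD ⊢
    simp only [or_true, if_true] at hD ⊢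
    generalize x.count (i + 2) = a at *
    generalize z.count (i + 2) = b at *
    rcases a with - | a
    · rcases b with - | b
      · rfl
      · exact absurd ⟨[i + 2, i + 1, i + 1], List.replicate b (i + 2), by simp [List.replicate_succ]⟩ hD
    · exact absurd ⟨List.replicate a (i + 2),
        [i + 1, i + 1] ++ (i + 2) :: List.replicate b (i + 2), by
          simp [List.replicate_succ']⟩ hD

theorem IsFCNatWord.edgeProj_after {u : List ℕ} (hu : IsFCNatWord u) {x y z t : List ℕ}
    (h : u = x ++ 1 :: (y ++ 0 :: (z ++ 1 :: t)))
    (hy : ∀ b ∈ y, b ≠ 0 ∧ b ≠ 1 ∧ b ≠ 2) (hz : ∀ b ∈ z, b ≠ 0 ∧ b ≠ 1 ∧ b ≠ 2) :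
    edgeProj 0 t = [] := by
  rcases hp : edgeProj 0 t with - | ⟨c, p⟩
  · rfl
  exfalso
  have hc : c = 0 ∨ c = 1 := by
    have : c ∈ edgeProj 0 t := by simp [hp]
    rw [mem_edgeProj] at this
    exact this.2
  rcases hc with rfl | rfl
  · rw [edgeProj, List.filter_eq_cons_iff] at hp
    obtain ⟨t1, t2, rfl, ht1, -, -⟩ := hp
    refine hu.not_quadruple hy hz (fun b hb => ?_) h
    have := ht1 b hb
    simpa using this
  · apply hu.not_succ_pair 0
    rw [h]
    refine ⟨edgeProj 0 (x ++ 1 :: (y ++ 0 :: z)), p, ?_⟩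
    rw [show x ++ 1 :: (y ++ 0 :: (z ++ 1 :: t)) = (x ++ 1 :: (y ++ 0 :: z)) ++ (1 :: t) by simp,
      edgeProj_append _ _ (1 :: t), edgeProj_cons 0 1 t, hp]
    simp

theorem IsFCNatWord.gap_one {u : List ℕ} (hu : IsFCNatWord u) (h : [1, 1] <:+: edgeProj 1 u) :
    edgeProj 0 u = [1, 0, 1] := by
  obtain ⟨x, y, z, rfl, hy⟩ := exists_of_pair_infix_edgeProj h
  rw [edgeProj_eq_nil] at hy
  have hm : 0 ∈ y := by
    by_contra hm
    refine hu.not_pair (i := 1) (fun b hb => ?_) rfl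
    have h0 : b ≠ 0 := fun h => hm (h ▸ hb)
    have h1 : b ≠ 1 := fun h => hy.1 (h ▸ hb)
    have h2 : b ≠ 1 + 1 := fun h => hy.2 (h ▸ hb)
    omega
  have hyr : edgeProj 0 y = List.replicate (y.count 0) 0 := by
    refine eq_replicate_edgeProj (by omega) ?_
    rintro b hb (rfl | rfl)
    · rfl
    · exact absurd hb hy.1
  have hc : y.count 0 = 1 := by
    have h1 : 1 ≤ y.count 0 := List.count_pos_iff.2 hm
    by_contra hc
    refine hu.not_zero_pair ((pair_infix_replicate (m := y.count 0) (by omega)).trans ?_)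
    rw [← hyr]
    exact List.IsInfix.edgeProj ⟨x ++ [1], 1 :: z, by simp⟩ _
  obtain ⟨y1, y2, rfl⟩ := List.append_of_mem hm
  have hc1 : y1.count 0 = 0 ∧ y2.count 0 = 0 := by
    simp only [List.count_append, List.count_cons_self] at hc
    omega
  rw [List.count_eq_zero, List.count_eq_zero] at hc1
  have hy1 : ∀ b ∈ y1, b ≠ 0 ∧ b ≠ 1 ∧ b ≠ 2 := by grind
  have hy2 : ∀ b ∈ y2, b ≠ 0 ∧ b ≠ 1 ∧ b ≠ 2 := by grind
  have hz := hu.edgeProj_after (x := x) (t := z) (by simp) hy1 hy2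
  have hx := hu.reverse.edgeProj_after (x := z.reverse) (y := y2.reverse) (z := y1.reverse)
    (t := x.reverse) (by simp) (by simpa using hy2) (by simpa using hy1)
  rw [edgeProj_reverse, List.reverse_eq_nil_iff] at hx
  rw [hc] at hyr
  simp only [edgeProj_append, edgeProj_cons 0 1, hx, hyr, hz]
  simp

end NatWords

section Alternating

variable {B : Type*} {a b : B}

theorem alternatingWord_succ_eq_append (a b : B) (m : ℕ) :
    alternatingWord a b (m + 1) = alternatingWord b a m ++ [b] := by
  rw [alternatingWord_succ, List.concat_eq_append]

theorem reverse_alternatingWord_two_mul_add_one (m : ℕ) :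
    (alternatingWord a b (2 * m + 1)).reverse = alternatingWord a b (2 * m + 1) := by
  rw [alternatingWord_succ_eq_append, List.reverse_append, reverse_alternatingWord_two_mul,
    ← alternatingWord_succ_eq_append, alternatingWord_succ', if_pos (by simp)]
  rfl

theorem reverse_alternatingWord_two_mul_ne (hab : a ≠ b) (m : ℕ) (hm : m ≠ 0) :
    (alternatingWord a b (2 * m)).reverse ≠ alternatingWord a b (2 * m) := by
  obtain ⟨m, rfl⟩ := Nat.exists_eq_succ_of_ne_zero hm
  rw [reverse_alternatingWord_two_mul, show 2 * (m + 1) = 2 * m + 1 + 1 by ring,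
    alternatingWord_succ_eq_append b a (2 * m + 1), alternatingWord_succ_eq_append a b (2 * m + 1)]
  intro h
  have := List.append_inj_right' h rfl
  simp only [List.cons.injEq, and_true] at this
  exact hab this

theorem not_pair_infix_alternatingWord (hab : a ≠ b) (x : B) (m : ℕ) :
    ¬ [x, x] <:+: alternatingWord a b m := by
  induction m generalizing a b with
  | zero => simp [alternatingWord]
  | succ m ih =>
    rw [alternatingWord_succ_eq_append, List.infix_concat_iff]
    rintro (h | h)
    · rcases m with - | m
      · simpa [alternatingWord] using h.length_le
      · rw [alternatingWord_succ_eq_append] at h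
        obtain ⟨t, ht⟩ := h
        have h1 := List.append_inj_right' (s₁ := t) (t₁ := [x, x]) (s₂ := alternatingWord a b m)
          (t₂ := [a, b]) (by simpa using ht) rfl
        simp at h1
        exact hab (h1.1.symm.trans h1.2)
    · exact ih hab.symm h

theorem count_alternatingWord [DecidableEq B] (hab : a ≠ b) (m : ℕ) :
    (alternatingWord a b m).count a = m / 2 ∧ (alternatingWord a b m).count b = (m + 1) / 2 := by
  induction m generalizing a b with
  | zero => simp [alternatingWord]
  | succ m ih =>
    obtain ⟨h1, h2⟩ := ih hab.symm
    rw [alternatingWord_succ_eq_append, List.count_append, List.count_append, h1, h2]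
    simp [hab.symm]
    omega

theorem exists_eq_alternatingWord (l : List B) (hl : ∀ x ∈ l, x = a ∨ x = b)
    (ha : ¬ [a, a] <:+: l) (hb : ¬ [b, b] <:+: l) :
    l = alternatingWord a b l.length ∨ l = alternatingWord b a l.length := by
  induction l using List.reverseRecOn generalizing a b with
  | nil => simp [alternatingWord]
  | append_singleton l c ih =>
    have ih' := ih (fun x hx => hl x (by simp [hx]))
      (fun h => ha (h.trans (List.prefix_append _ _).isInfix))
      (fun h => hb (h.trans (List.prefix_append _ _).isInfix))
    have key : ∀ a b : B, (c = a ∨ c = b) → ¬ [a, a] <:+: l ++ [c] → ¬ [b, b] <:+: l ++ [c] →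
        l = alternatingWord a b l.length →
        l ++ [c] = alternatingWord a b (l ++ [c]).length ∨
          l ++ [c] = alternatingWord b a (l ++ [c]).length := by
      intro a b hc ha hb hl
      rw [List.length_append, List.length_singleton, alternatingWord_succ_eq_append, alternatingWord_succ_eq_append,
        ← hl]
      rcases hc with rfl | rfl
      · right; rfl
      · rcases hn : l.length with - | m
        · left
          rw [List.length_eq_zero_iff] at hn
          simp [hn, alternatingWord]
        · rw [hn, alternatingWord_succ_eq_append] at hl
          refine absurd ⟨alternatingWord c a m, [], ?_⟩ hb
          rw [hl]
          simp
    have hc := hl c (by simp)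
    rcases ih' with h | h
    · exact key a b hc ha hb h
    · exact (key b a hc.symm hb ha h).symm

end Alternating

section Data

/-- Lattice paths reaching height `0` from position `n` on, with a horizontal step at height `0`
in place of a step below `0`. -/
def IsPath (n : ℕ) (h : ℕ → ℕ) : Prop :=
  (∀ k, n ≤ k → h k = 0) ∧ ∀ k, h k = h (k + 1) + 1 ∨ h k = h (k + 1) - 1

/-- The combinatorial data parametrizing fully commutative involutions in type `B`. -/
def IsDatum (n j : ℕ) (h : ℕ → ℕ) : Prop :=
  IsPath n h ∧ (j = 0 ∨ 1 ≤ j ∧ (∀ k < j, h k = 0) ∧ h j = 1)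

/-- The projections of the word attached to a datum. -/
def datumProj (j : ℕ) (h : ℕ → ℕ) (k : ℕ) : List ℕ :=
  if k < j then if k = 0 then [1, 0, 1] else [k + 1, k, k, k + 1]
  else if k = j ∧ 1 ≤ j then if h (j + 1) = 0 then [j, j] else [j + 1, j, j, j + 1]
  else if h k = h (k + 1) + 1 then alternatingWord (k + 1) k (h k + h (k + 1))
  else alternatingWord k (k + 1) (h k + h (k + 1))

theorem count_edgeProj_self (k : ℕ) (u : List ℕ) : (edgeProj k u).count k = u.count k := by
  rw [edgeProj, List.count_filter (by simp)]

theorem count_edgeProj_succ (k : ℕ) (u : List ℕ) :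
    (edgeProj k u).count (k + 1) = u.count (k + 1) := by
  rw [edgeProj, List.count_filter (by simp)]

theorem edgeProj_of_not_pair {u : List ℕ} {k : ℕ} (h1 : ¬ [k, k] <:+: edgeProj k u)
    (h2 : ¬ [k + 1, k + 1] <:+: edgeProj k u) (hpal : (edgeProj k u).reverse = edgeProj k u) :
    (u.count k = u.count (k + 1) + 1 ∨ u.count k = u.count (k + 1) - 1) ∧
    edgeProj k u = if u.count k = u.count (k + 1) + 1
      then alternatingWord (k + 1) k (u.count k + u.count (k + 1))
      else alternatingWord k (k + 1) (u.count k + u.count (k + 1)) := by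
  have hne : k ≠ k + 1 := by omega
  rw [← count_edgeProj_self, ← count_edgeProj_succ]
  have hmem : ∀ x ∈ edgeProj k u, x = k ∨ x = k + 1 := fun x hx => (mem_edgeProj.1 hx).2
  generalize edgeProj k u = l at *
  have hlen : l.length = 0 ∨ l.length % 2 = 1 := by
    by_contra hc
    obtain ⟨m, hm⟩ : ∃ m, l.length = 2 * m := ⟨l.length / 2, by omega⟩
    rcases exists_eq_alternatingWord l hmem h1 h2 with h | h
    · rw [h, hm] at hpal
      exact reverse_alternatingWord_two_mul_ne hne m (by omega) hpal
    · rw [h, hm] at hpal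
      exact reverse_alternatingWord_two_mul_ne hne.symm m (by omega) hpal
  rcases exists_eq_alternatingWord l hmem h1 h2 with h | h
  · obtain ⟨c1, c2⟩ := count_alternatingWord hne l.length
    rw [← h] at c1 c2
    refine ⟨by omega, ?_⟩
    rw [if_neg (by omega), show l.count k + l.count (k + 1) = l.length by omega]
    exact h
  · obtain ⟨c1, c2⟩ := count_alternatingWord hne.symm l.length
    rw [← h] at c1 c2
    refine ⟨by omega, ?_⟩
    rcases hlen with h0 | h0
    · rw [List.length_eq_zero_iff] at h0
      subst h0
      simp [alternatingWord]
    · rw [if_pos (by omega), show l.count k + l.count (k + 1) = l.length by omega]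
      exact h

theorem edgeProj_of_pair {u : List ℕ} {k : ℕ} (h1 : [k, k] <:+: edgeProj k u)
    (h2 : ¬ [k + 1, k + 1] <:+: edgeProj k u) (hpal : (edgeProj k u).reverse = edgeProj k u)
    (hc : u.count k = 2) :
    (u.count (k + 1) = 0 ∧ edgeProj k u = [k, k]) ∨
      (u.count (k + 1) = 2 ∧ edgeProj k u = [k + 1, k, k, k + 1]) := by
  rw [← count_edgeProj_self] at hc
  rw [← count_edgeProj_succ]
  have hmem : ∀ x ∈ edgeProj k u, x = k ∨ x = k + 1 := fun x hx => (mem_edgeProj.1 hx).2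
  generalize edgeProj k u = l at *
  obtain ⟨s, t, rfl⟩ := h1
  simp only [List.count_append, List.count_cons_self] at hc
  have hs : s.count k = 0 := by simp at hc; omega
  have ht : t.count k = 0 := by simp at hc; omega
  rw [List.count_eq_zero] at hs ht
  have key (r : List ℕ) (hr : r <:+: s ++ [k, k] ++ t) (hk : k ∉ r) : r = [] ∨ r = [k + 1] := by
    have h : r = List.replicate r.length (k + 1) := by
      rw [List.eq_replicate_iff]
      refine ⟨rfl, fun b hb => ?_⟩
      rcases hmem b (hr.subset hb) with rfl | h
      · exact absurd hb hk
      · exact h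
    have hlen : r.length < 2 := by
      by_contra hc
      have := pair_infix_replicate (i := k + 1) (m := r.length) (by omega)
      rw [← h] at this
      exact h2 (this.trans hr)
    have h' : r.length = 0 ∨ r.length = 1 := by omega
    rcases h' with h' | h' <;> rw [h'] at h <;> simp [h]
  have hs' := key s (by rw [List.append_assoc]; exact (List.prefix_append _ _).isInfix) hs
  have ht' := key t (List.suffix_append _ _).isInfix ht
  rcases hs' with rfl | rfl <;> rcases ht' with rfl | rfl <;> simp at hpal ⊢

theorem IsFCNatWord.exists_datum {n : ℕ} {u : List ℕ} (hu : IsFCNatWord u) (hlt : ∀ x ∈ u, x < n)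
    (hpal : ∀ k, (edgeProj k u).reverse = edgeProj k u) :
    ∃ j h, IsDatum n j h ∧ ∀ k, edgeProj k u = datumProj j h k := by
  classical
  set G : ℕ → Prop := fun i => 1 ≤ i ∧ [i, i] <:+: edgeProj i u with hG
  have hGn (i : ℕ) (hi : G i) : i < n :=
    hlt i (mem_edgeProj.1 (hi.2.subset (List.mem_cons_self (a := i)))).1
  obtain ⟨j, hj⟩ : ∃ j, j = Nat.findGreatest G n := ⟨_, rfl⟩
  have hjG : 1 ≤ j → G j := by
    intro h
    exact Nat.findGreatest_of_ne_zero hj.symm (by omega)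
  have hnG (k : ℕ) (hk : j < k) : ¬ G k := fun h =>
    Nat.findGreatest_is_greatest (hj ▸ hk) (hGn k h).le h
  have hdown (d : ℕ) (hd : d < j) : G (j - d) := by
    induction d with
    | zero => exact hjG hd
    | succ d ih =>
      have h := ih (by omega)
      obtain ⟨i, hi⟩ : ∃ i, j - d = i + 2 := ⟨j - d - 2, by omega⟩
      rw [hi] at h
      rw [show j - (d + 1) = i + 1 by omega]
      exact ⟨by omega, (hu.gap_step h.2).1⟩
  have hGle (k : ℕ) (hk : 1 ≤ k) (hkj : k ≤ j) : G k := by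
    have := hdown (j - k) (by omega)
    rwa [show j - (j - k) = k by omega] at this
  have hzero : 1 ≤ j → edgeProj 0 u = [1, 0, 1] := fun h => hu.gap_one (hGle 1 le_rfl h).2
  have hsucc (k : ℕ) (hkj : k + 1 ≤ j) : u.count (k + 1) = 2 ∧
      (1 ≤ k → edgeProj k u = [k + 1, k, k, k + 1]) := by
    induction k with
    | zero =>
      refine ⟨?_, by omega⟩
      rw [← count_edgeProj_succ, hzero hkj]
      rfl
    | succ k ih =>
      have h := (hu.gap_step (hGle (k + 2) (by omega) hkj).2).2 (ih (by omega)).1.le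
      refine ⟨?_, fun _ => h⟩
      rw [← count_edgeProj_succ, h]
      simp
  have hmid (hj1 : 1 ≤ j) := edgeProj_of_pair (hjG hj1).2 (hu.not_succ_pair j) (hpal j) (by
    have := (hsucc (j - 1) (by omega)).1
    rwa [show j - 1 + 1 = j by omega] at this)
  have hhigh (k : ℕ) (hk : j < k ∨ k = 0 ∧ j = 0) := edgeProj_of_not_pair (u := u) (k := k) (by
    rcases hk with hk | ⟨rfl, -⟩
    · exact fun h => hnG k hk ⟨by omega, h⟩
    · exact hu.not_zero_pair) (hu.not_succ_pair k) (hpal k)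
  refine ⟨j, fun k => if k < j then 0 else if k = j ∧ 1 ≤ j then 1 else u.count k,
    ⟨⟨fun k hk => ?_, fun k => ?_⟩, ?_⟩, fun k => ?_⟩
  · have h0 : u.count k = 0 := List.count_eq_zero.2 fun h => by
      have := hlt k h
      omega
    by_cases hk1 : k < j
    · simp [hk1]
    by_cases hk2 : k = j ∧ 1 ≤ j
    · have := hGn j (hjG hk2.2)
      omega
    · simp [hk1, hk2, h0]
  · rcases lt_trichotomy k j with hk | hk | hk
    · by_cases hk1 : k + 1 < j
      · simp [hk, hk1]
      · simp [hk, show k + 1 = j ∧ 1 ≤ j by omega]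
    · rcases Nat.eq_zero_or_pos j with h0 | h0
      · have := (hhigh k (.inr (by omega))).1
        simpa [h0] using this
      · have h1 := hmid h0
        subst hk
        simp [Nat.succ_le_iff.2 h0]
        omega
    · have := (hhigh k (.inl hk)).1
      have e1 : ¬ k < j := by omega
      have e2 : ¬ (k = j) := by omega
      have e3 : ¬ k + 1 < j := by omega
      have e4 : ¬ (k + 1 = j) := by omega
      simpa [e1, e2, e3, e4] using this
  · rcases Nat.eq_zero_or_pos j with h0 | h0
    · exact .inl h0
    · refine .inr ⟨h0, fun k hk => by simp [hk], ?_⟩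
      simp [Nat.succ_le_iff.2 h0]
  · rcases lt_trichotomy k j with hk | hk | hk
    · rw [datumProj, if_pos hk]
      split_ifs with h0
      · rw [h0]
        exact hzero (by omega)
      · exact (hsucc k hk).2 (by omega)
    · rcases Nat.eq_zero_or_pos j with h0 | h0
      · have := (hhigh k (.inr (by omega))).2
        simpa [datumProj, h0] using this
      · have h1 := hmid h0
        subst hk
        simp [datumProj, Nat.succ_le_iff.2 h0]
        rcases h1 with h1 | h1 <;> simp [h1]
    · have := (hhigh k (.inl hk)).2
      have e1 : ¬ k < j := by omega
      have e2 : ¬ (k = j) := by omega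
      have e3 : ¬ k + 1 < j := by omega
      have e4 : ¬ (k + 1 = j) := by omega
      simpa [datumProj, e1, e2, e3, e4] using this

end Data

section Realization

variable {n j k : ℕ} {h : ℕ → ℕ}

theorem datumProj_of_lt (hk : j < k ∨ j = 0) : datumProj j h k =
    if h k = h (k + 1) + 1 then alternatingWord (k + 1) k (h k + h (k + 1))
    else alternatingWord k (k + 1) (h k + h (k + 1)) := by
  rw [datumProj, if_neg (by omega), if_neg (by omega)]

theorem datumProj_not_pair (hk : j < k ∨ j = 0) (x : ℕ) : ¬ [x, x] <:+: datumProj j h k := by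
  rw [datumProj_of_lt hk]
  split_ifs
  · exact not_pair_infix_alternatingWord (by omega) x _
  · exact not_pair_infix_alternatingWord (by omega) x _

theorem IsPath.count_datumProj (hp : IsPath n h) (hk : j < k ∨ j = 0) :
    (datumProj j h k).count k = h k ∧ (datumProj j h k).count (k + 1) = h (k + 1) := by
  have := hp.2 k
  rw [datumProj_of_lt hk]
  split_ifs
  · obtain ⟨h1, h2⟩ := count_alternatingWord (show k + 1 ≠ k by omega) (h k + h (k + 1))
    omega
  · obtain ⟨h1, h2⟩ := count_alternatingWord (show k ≠ k + 1 by omega) (h k + h (k + 1))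
    omega

theorem datumProj_of_eq (hj : 1 ≤ j) :
    datumProj j h j = if h (j + 1) = 0 then [j, j] else [j + 1, j, j, j + 1] := by
  rw [datumProj, if_neg (by omega), if_pos ⟨rfl, hj⟩]

theorem datumProj_zero (hj : 1 ≤ j) : datumProj j h 0 = [1, 0, 1] := by
  rw [datumProj, if_pos (by omega), if_pos rfl]

theorem datumProj_of_gt (hk : 1 ≤ k) (hkj : k < j) : datumProj j h k = [k + 1, k, k, k + 1] := by
  rw [datumProj, if_pos (by omega), if_neg (by omega)]

theorem datumProj_cases (j k : ℕ) : (j < k ∨ j = 0) ∨ (1 ≤ j ∧ k = j) ∨ (1 ≤ j ∧ k = 0) ∨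
    (1 ≤ k ∧ k < j) := by
  omega

theorem mem_datumProj {x : ℕ} (hx : x ∈ datumProj j h k) : x = k ∨ x = k + 1 := by
  have key : ∀ (a b m : ℕ), x ∈ alternatingWord a b m → x = a ∨ x = b := by
    intro a b m
    induction m generalizing a b with
    | zero => simp [alternatingWord]
    | succ m ih =>
      rw [alternatingWord_succ_eq_append, List.mem_append, List.mem_singleton]
      rintro (h | h)
      · exact (ih b a h).symm
      · exact .inr h
  rw [datumProj] at hx
  split_ifs at hx
  · simp at hx
    omega
  · simp at hx
    omega
  · simp at hx
    omega
  · simp at hx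
    omega
  · have := key _ _ _ hx
    omega
  · exact key _ _ _ hx

theorem IsDatum.count_succ_datumProj (hd : IsDatum n j h) (k : ℕ) :
    (datumProj j h k).count (k + 1) = (datumProj j h (k + 1)).count (k + 1) := by
  have hp := hd.1
  rcases datumProj_cases j k with hk | ⟨hj, rfl⟩ | ⟨hj, rfl⟩ | ⟨hk, hkj⟩
  · rw [(hp.count_datumProj hk).2, (hp.count_datumProj (by omega)).1]
  · have h1 : h k = 1 := by
      have := hd.2
      omega
    have := hp.2 k
    rw [(hp.count_datumProj (by omega)).1, datumProj_of_eq hj]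
    split_ifs with h0
    · simp [h0]
    · simp
      omega
  · rw [datumProj_zero hj]
    rcases hj.lt_or_eq with hj | rfl
    · rw [datumProj_of_gt (by omega) (by omega)]
      simp
    · rw [datumProj_of_eq le_rfl]
      split_ifs <;> simp
  · rw [datumProj_of_gt hk hkj]
    rcases (Nat.succ_le_iff.2 hkj).lt_or_eq with hj | rfl
    · rw [datumProj_of_gt (by omega) hj]
      simp
    · rw [datumProj_of_eq (by omega)]
      split_ifs <;> simp

theorem exists_amalgam (m : ℕ) (p a : List ℕ) (ha : ∀ x ∈ a, x ≤ m)
    (hp : ∀ x ∈ p, x = m ∨ x = m + 1) (h : a.filter (· = m) = p.filter (· = m)) :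
    ∃ b : List ℕ, b.filter (· ≤ m) = a ∧ edgeProj m b = p ∧ ∀ x ∈ b, x ≤ m + 1 := by
  induction p generalizing a with
  | nil =>
    have hm : m ∉ a := fun hm => by
      have : m ∈ a.filter (· = m) := by simpa using hm
      simp [h] at this
    refine ⟨a, by simpa using ha, edgeProj_eq_nil.2 ⟨hm, fun hm => ?_⟩, fun x hx => ?_⟩
    · have := ha _ hm
      omega
    · have := ha _ hx
      omega
  | cons c p ih =>
    rcases hp c (by simp) with rfl | rfl
    · rw [List.filter_cons_of_pos (by simp), List.filter_eq_cons_iff] at h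
      obtain ⟨a1, a2, rfl, ha1, -, h⟩ := h
      obtain ⟨b, hb1, hb2, hb3⟩ := ih a2 (fun x hx => ha x (by simp [hx]))
        (fun x hx => hp x (by simp [hx])) h
      have ha1' : ∀ x ∈ a1, x < c := fun x hx => by
        have h1 := ha x (by simp [hx])
        have h2 : x ≠ c := by simpa using ha1 x hx
        omega
      have e1 : edgeProj c a1 = [] := edgeProj_eq_nil.2
        ⟨fun hm => (ha1' _ hm).false, fun hm => by have := ha1' _ hm; omega⟩
      refine ⟨a1 ++ c :: b, ?_, ?_, ?_⟩
      · rw [List.filter_append, List.filter_cons_of_pos (by simp), hb1,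
          List.filter_eq_self.2 fun x hx => by simpa using (ha1' x hx).le]
      · rw [edgeProj_append, e1, edgeProj_cons, hb2]
        simp
      · intro x hx
        rw [List.mem_append, List.mem_cons] at hx
        rcases hx with hx | rfl | hx
        · have := ha1' x hx
          omega
        · omega
        · exact hb3 x hx
    · rw [List.filter_cons_of_neg (by simp)] at h
      obtain ⟨b, hb1, hb2, hb3⟩ := ih a ha (fun x hx => hp x (by simp [hx])) h
      refine ⟨(m + 1) :: b, ?_, ?_, ?_⟩
      · rw [List.filter_cons_of_neg (by simp), hb1]
      · rw [edgeProj_cons, hb2]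
        simp
      · simpa using hb3

theorem IsDatum.exists_partial (hd : IsDatum n j h) (m : ℕ) :
    ∃ a : List ℕ, (∀ x ∈ a, x ≤ m) ∧ (∀ k < m, edgeProj k a = datumProj j h k) ∧
      a.count m = (datumProj j h m).count m := by
  induction m with
  | zero =>
    refine ⟨List.replicate ((datumProj j h 0).count 0) 0, ?_, by simp, by simp⟩
    intro x hx
    exact (List.eq_of_mem_replicate hx).le
  | succ m ih =>
    obtain ⟨a, ha1, ha2, ha3⟩ := ih
    obtain ⟨b, hb1, hb2, hb3⟩ := exists_amalgam m (datumProj j h m) a ha1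
      (fun x hx => mem_datumProj hx) (by rw [List.filter_eq, List.filter_eq, ha3])
    refine ⟨b, hb3, fun k hk => ?_, ?_⟩
    · rcases (Nat.lt_succ_iff.1 hk).lt_or_eq with hk | rfl
      · rw [← ha2 k hk, ← hb1, edgeProj, edgeProj, List.filter_filter]
        refine List.filter_congr fun x _ => ?_
        simp
        omega
      · exact hb2
    · rw [← hd.count_succ_datumProj, ← hb2, count_edgeProj_succ]

theorem IsDatum.datumProj_eq_nil (hd : IsDatum n j h) (hk : n ≤ k) : datumProj j h k = [] := by
  obtain ⟨hp, hj⟩ := hd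
  have hjn : j < k ∨ j = 0 := by
    rcases hj with hj | ⟨-, -, hj⟩
    · exact .inr hj
    · left
      by_contra hc
      have := hp.1 j (by omega)
      omega
  rw [datumProj_of_lt hjn, hp.1 k hk, hp.1 (k + 1) (by omega)]
  simp [alternatingWord]

theorem IsDatum.exists_word (hd : IsDatum n j h) :
    ∃ a : List ℕ, (∀ x ∈ a, x < n) ∧ ∀ k, edgeProj k a = datumProj j h k := by
  obtain ⟨a, ha1, ha2, ha3⟩ := hd.exists_partial n
  rw [hd.datumProj_eq_nil le_rfl, List.count_nil, List.count_eq_zero] at ha3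
  have hlt : ∀ x ∈ a, x < n := fun x hx => (ha1 x hx).lt_of_ne fun h => ha3 (h ▸ hx)
  refine ⟨a, hlt, fun k => ?_⟩
  rcases lt_or_ge k n with hk | hk
  · exact ha2 k hk
  · rw [hd.datumProj_eq_nil hk, edgeProj_eq_nil]
    constructor <;> intro hx <;> have := hlt _ hx <;> omega

theorem datumProj_not_succ_pair : ¬ [k + 1, k + 1] <:+: datumProj j h k := by
  rcases datumProj_cases j k with hk | ⟨hj, rfl⟩ | ⟨hj, rfl⟩ | ⟨hk, hkj⟩
  · exact datumProj_not_pair hk _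
  · rw [datumProj_of_eq hj]
    split_ifs <;> simp [List.infix_cons_iff]
  · rw [datumProj_zero hj]
    simp [List.infix_cons_iff]
  · rw [datumProj_of_gt hk hkj]
    simp [List.infix_cons_iff]

theorem isFCNatWord_of_edgeProj_eq {u : List ℕ} (hu : ∀ k, edgeProj k u = datumProj j h k) :
    IsFCNatWord u := by
  intro v huv
  have hv (k : ℕ) : edgeProj k v = datumProj j h k := by rw [← huv k, hu k]
  have hsub {p : List ℕ} (hp : p <:+: v) (k : ℕ) : edgeProj k p <:+: datumProj j h k := by
    rw [← hv k]
    exact hp.edgeProj k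
  refine ⟨fun i hi => ?_, fun i hi => ⟨fun hv => ?_, fun hv => ?_⟩, fun hv => ?_, fun hv => ?_⟩
  · rcases i with - | i
    · have h0 := hsub hi 0
      rcases Nat.eq_zero_or_pos j with hj | hj
      · exact datumProj_not_pair (.inr hj) _ h0
      · rw [datumProj_zero hj] at h0
        simp [List.infix_cons_iff, edgeProj] at h0
    · refine datumProj_not_succ_pair (k := i) (j := j) (h := h) ?_
      simpa [edgeProj] using hsub hi i
  · obtain ⟨i, rfl⟩ := Nat.exists_eq_add_of_le' hi
    refine datumProj_not_succ_pair (k := i) (j := j) (h := h) ?_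
    simpa [edgeProj_cons, edgeProj_nil, show i + 1 + 1 ≠ i by omega] using hsub hv i
  · have h1 : [i + 1, i + 1] <:+: datumProj j h (i + 1) := by
      simpa [edgeProj_cons, edgeProj_nil, show i ≠ i + 1 + 1 by omega] using hsub hv (i + 1)
    have hij : i < j := by
      by_contra hc
      exact datumProj_not_pair (by omega) _ h1
    have h2 := hsub hv i
    rw [datumProj_of_gt hi hij] at h2
    simp [List.infix_cons_iff, edgeProj] at h2
  · have h1 : [1, 1] <:+: datumProj j h 1 := by simpa [edgeProj] using hsub hv 1
    have hj : 1 ≤ j := by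
      by_contra hc
      exact datumProj_not_pair (by omega) _ h1
    have h2 := (hsub hv 0).length_le
    rw [datumProj_zero hj] at h2
    simp [edgeProj] at h2
  · have h1 : [1, 1] <:+: datumProj j h 1 := by simpa [edgeProj] using hsub hv 1
    have hj : 1 ≤ j := by
      by_contra hc
      exact datumProj_not_pair (by omega) _ h1
    have h2 := (hsub hv 0).length_le
    rw [datumProj_zero hj] at h2
    simp [edgeProj] at h2

theorem IsPath.reverse_datumProj (hp : IsPath n h) (k : ℕ) :
    (datumProj j h k).reverse = datumProj j h k := by
  rcases datumProj_cases j k with hk | ⟨hj, rfl⟩ | ⟨hj, rfl⟩ | ⟨hk, hkj⟩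
  · have hs := hp.2 k
    have key : ∀ a b : ℕ, (alternatingWord a b (h k + h (k + 1))).reverse =
        alternatingWord a b (h k + h (k + 1)) := by
      intro a b
      by_cases h0 : h k + h (k + 1) = 0
      · rw [h0]
        rfl
      · rw [show h k + h (k + 1) = 2 * ((h k + h (k + 1)) / 2) + 1 by omega]
        exact reverse_alternatingWord_two_mul_add_one _
    rw [datumProj_of_lt hk]
    split_ifs <;> exact key _ _
  · rw [datumProj_of_eq hj]
    split_ifs <;> simp
  · rw [datumProj_zero hj]
    rfl
  · rw [datumProj_of_gt hk hkj]
    simp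

theorem IsDatum.eq_of_datumProj_eq {j' : ℕ} {h' : ℕ → ℕ} (hd : IsDatum n j h)
    (hd' : IsDatum n j' h') (heq : ∀ k, datumProj j h k = datumProj j' h' k) :
    j = j' ∧ h = h' := by
  have hpair {j : ℕ} {h : ℕ → ℕ} (hj : 1 ≤ j) : [j, j] <:+: datumProj j h j := by
    rw [datumProj_of_eq hj]
    split_ifs
    · exact List.infix_rfl
    · exact ⟨[j + 1], [j + 1], rfl⟩
  have hjj : j = j' := by
    rcases lt_trichotomy j j' with hlt | hlt | hlt
    · exact absurd (heq j' ▸ hpair (by omega)) (datumProj_not_pair (.inl hlt) j')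
    · exact hlt
    · exact absurd (heq j ▸ hpair (by omega)) (datumProj_not_pair (.inl hlt) j)
  subst hjj
  refine ⟨rfl, funext fun k => ?_⟩
  by_cases hk : j < k ∨ j = 0
  · rw [← (hd.1.count_datumProj hk).1, ← (hd'.1.count_datumProj hk).1, heq k]
  · rcases hd.2 with h0 | ⟨-, h1, h2⟩
    · omega
    rcases hd'.2 with h0 | ⟨-, h1', h2'⟩
    · omega
    rcases lt_or_ge k j with hkj | hkj
    · rw [h1 k hkj, h1' k hkj]
    · rw [show k = j by omega, h2, h2']

end Realization

section Link

variable {n : ℕ}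

theorem edgeProj_map_typeBRank (k : ℕ) (u : List (Fin n)) : edgeProj k (u.map typeBRank) =
    (u.filter fun x => typeBRank x = k ∨ typeBRank x = k + 1).map typeBRank := by
  rw [edgeProj, List.filter_map]
  rfl

theorem commEquiv_typeB_iff {u v : List (Fin n)} :
    CommEquiv (typeB n) u v ↔ ProjEq (u.map typeBRank) (v.map typeBRank) := by
  constructor
  · intro h k
    have key (a b : Fin n) (hab : typeB n a b ≠ 2)
        (hk : ∀ x : Fin n, (typeBRank x = k ∨ typeBRank x = k + 1) ↔ (x = a ∨ x = b)) :
        edgeProj k (u.map typeBRank) = edgeProj k (v.map typeBRank) := by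
      simp only [edgeProj_map_typeBRank, hk, h.filter_eq hab]
    rcases lt_or_ge k n with hk | hk
    · obtain ⟨a, ha⟩ := exists_typeBRank_eq hk
      rcases lt_or_ge (k + 1) n with hk1 | hk1
      · obtain ⟨b, hb⟩ := exists_typeBRank_eq hk1
        refine key a b ?_ fun x => ?_
        · rw [typeB_apply]
          split_ifs <;> omega
        · rw [← hb, ← ha, typeBRank_injective.eq_iff, typeBRank_injective.eq_iff]
      · refine key a a ?_ fun x => ?_
        · rw [typeB_apply]
          split_ifs <;> omega
        · rw [← typeBRank_injective.eq_iff, ha]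
          have := typeBRank_lt x
          omega
    · have hnil (u : List (Fin n)) : edgeProj k (u.map typeBRank) = [] := by
        rw [edgeProj_eq_nil]
        constructor <;> intro hx <;> obtain ⟨x, -, hx⟩ := List.mem_map.1 hx <;>
          have := typeBRank_lt x <;> omega
      rw [hnil, hnil]
  · intro h
    refine .of_filter_eq fun a b hab => ?_
    have hk := h (min (typeBRank a) (typeBRank b))
    rw [edgeProj_map_typeBRank, edgeProj_map_typeBRank,
      (List.map_injective_iff.2 typeBRank_injective).eq_iff] at hk
    have hsub (u : List (Fin n)) : u.filter (fun x => x = a ∨ x = b) =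
        (u.filter fun x => typeBRank x = min (typeBRank a) (typeBRank b) ∨
          typeBRank x = min (typeBRank a) (typeBRank b) + 1).filter (fun x => x = a ∨ x = b) := by
      rw [List.filter_filter]
      refine List.filter_congr fun x _ => ?_
      rw [typeB_apply] at hab
      have : (x = a ∨ x = b) → (typeBRank x = min (typeBRank a) (typeBRank b) ∨
          typeBRank x = min (typeBRank a) (typeBRank b) + 1) := by
        rintro (rfl | rfl) <;> split_ifs at hab <;> omega
      simp only [← Bool.decide_and, decide_eq_decide]
      tauto
    rw [hsub u, hsub v, hk]

theorem isFCWord_typeB_iff {u : List (Fin n)} :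
    IsFCWord (typeB n) u ↔ IsFCNatWord (u.map typeBRank) := by
  constructor
  · intro h v huv
    obtain ⟨v, rfl⟩ : ∃ v' : List (Fin n), v'.map typeBRank = v := by
      have : v ∈ Set.range (List.map (typeBRank (n := n))) := by
        rw [Set.range_list_map]
        intro x hx
        have hx' : x ∈ edgeProj x (u.map typeBRank) := by
          rw [huv x, mem_edgeProj]
          exact ⟨hx, .inl rfl⟩
        obtain ⟨y, -, hy⟩ := List.mem_map.1 (mem_edgeProj.1 hx').1
        exact ⟨y, hy⟩
      exact this
    obtain ⟨h1, h2⟩ := h v (commEquiv_typeB_iff.2 huv)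
    have h3 (i k : ℕ) (hik : i + 1 = k ∨ k + 1 = i) (hi : 1 ≤ i) (hk : 1 ≤ k) :
        ¬ [i, k, i] <:+: v.map typeBRank := by
      intro hi
      obtain ⟨q, hq, hqi⟩ := List.infix_map_iff.1 hi
      rw [eq_comm] at hqi
      simp only [List.map_eq_cons_iff, List.map_eq_nil_iff] at hqi
      obtain ⟨s, -, rfl, hs, t, -, rfl, ht, s', -, rfl, hs', rfl⟩ := hqi
      rw [← hs', typeBRank_injective.eq_iff] at hs
      subst hs
      have h3 : typeB n t s = 3 := by
        rw [typeB_apply]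
        split_ifs <;> omega
      refine h2 t s ?_ (by omega) ?_
      · rintro rfl
        omega
      · rw [h3]
        exact hq
    have h4 (i k : ℕ) (hik : i = 0 ∧ k = 1 ∨ i = 1 ∧ k = 0) :
        ¬ [i, k, i, k] <:+: v.map typeBRank := by
      intro hi
      obtain ⟨q, hq, hqi⟩ := List.infix_map_iff.1 hi
      rw [eq_comm] at hqi
      simp only [List.map_eq_cons_iff, List.map_eq_nil_iff] at hqi
      obtain ⟨s, -, rfl, hs, t, -, rfl, ht, s', -, rfl, hs', t', -, rfl, ht', rfl⟩ := hqi
      rw [← hs', typeBRank_injective.eq_iff] at hs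
      rw [← ht', typeBRank_injective.eq_iff] at ht
      subst hs ht
      have h3 : typeB n s t = 4 := by
        rw [typeB_apply]
        split_ifs <;> omega
      refine h2 s t ?_ (by omega) ?_
      · rintro rfl
        omega
      · rw [h3]
        exact hq
    refine ⟨fun i hi => ?_, fun i hi => ⟨h3 _ _ (by omega) hi (by omega),
      h3 _ _ (by omega) (by omega) hi⟩, h4 _ _ (by omega), h4 _ _ (by omega)⟩
    obtain ⟨q, hq, hqi⟩ := List.infix_map_iff.1 hi
    rw [eq_comm] at hqi
    simp only [List.map_eq_cons_iff, List.map_eq_nil_iff] at hqi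
    obtain ⟨s, -, rfl, hs, s', -, rfl, hs', rfl⟩ := hqi
    rw [← hs', typeBRank_injective.eq_iff] at hs
    subst hs
    exact h1 _ hq
  · intro h v huv
    obtain ⟨h1, h2, h3, h4⟩ := h _ (commEquiv_typeB_iff.1 huv)
    refine ⟨fun s hs => h1 _ (hs.map typeBRank), fun s t hst hm ht => ?_⟩
    have ht' := ht.map typeBRank
    have hne : typeBRank s ≠ typeBRank t := fun h => hst (typeBRank_injective h)
    rw [typeB_apply, if_neg hne] at ht' hm
    split_ifs at ht' hm with h5 h6
    · change [typeBRank s, typeBRank t, typeBRank s, typeBRank t] <:+: _ at ht'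
      have h7 : typeBRank s = 0 ∧ typeBRank t = 1 ∨ typeBRank s = 1 ∧ typeBRank t = 0 := by omega
      rcases h7 with ⟨h7, h8⟩ | ⟨h7, h8⟩ <;> rw [h7, h8] at ht'
      · exact h3 ht'
      · exact h4 ht'
    · change [typeBRank t, typeBRank s, typeBRank t] <:+: _ at ht'
      rcases h5 with h5 | h5
      · rw [← h5] at ht'
        exact (h2 _ (by omega)).2 ht'
      · rw [← h5] at ht'
        exact (h2 _ (by omega)).1 ht'
    · omega

theorem IsDatum.exists_typeB_word {j : ℕ} {h : ℕ → ℕ} (hd : IsDatum n j h) :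
    ∃ u : List (Fin n), ∀ k, edgeProj k (u.map typeBRank) = datumProj j h k := by
  obtain ⟨a, ha, hk⟩ := hd.exists_word
  have : a ∈ Set.range (List.map (typeBRank (n := n))) := by
    rw [Set.range_list_map]
    exact fun x hx => exists_typeBRank_eq (ha x hx)
  obtain ⟨u, rfl⟩ := this
  exact ⟨u, hk⟩

theorem commEquiv_typeB_reverse_iff {u : List (Fin n)} : CommEquiv (typeB n) u u.reverse ↔
    ∀ k, (edgeProj k (u.map typeBRank)).reverse = edgeProj k (u.map typeBRank) := by
  rw [commEquiv_typeB_iff]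
  refine forall_congr' fun k => ?_
  rw [List.map_reverse, edgeProj_reverse, eq_comm]

theorem card_fcInvolutions_eq_card_datum (n : ℕ) :
    Nat.card {w : (typeB n).Group // IsFCInvolution (typeB n).toCoxeterSystem w} =
      Nat.card {p : ℕ × (ℕ → ℕ) // IsDatum n p.1 p.2} := by
  set cs := (typeB n).toCoxeterSystem with hcs
  choose word hword using fun p : {p : ℕ × (ℕ → ℕ) // IsDatum n p.1 p.2} => p.2.exists_typeB_word
  have hFC (p) : IsFCWord (typeB n) (word p) :=
    isFCWord_typeB_iff.2 (isFCNatWord_of_edgeProj_eq (hword p))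
  have hred (p) := (hFC p).isReduced_and_commEquiv cs typeB_ne_zero
    typeB_simple_mul_simple_pow_ne_one
  have hrev (p) : CommEquiv (typeB n) (word p) (word p).reverse := by
    rw [commEquiv_typeB_reverse_iff]
    intro k
    rw [hword p, p.2.1.reverse_datumProj]
  symm
  refine Nat.card_eq_of_bijective (fun p => ⟨cs.wordProd (word p), ?_, ?_⟩) ⟨?_, ?_⟩
  · intro u v hu huw hv hvw
    exact ((hred p).2 u hu huw).symm.trans ((hred p).2 v hv hvw)
  · nth_rw 2 [(hrev p).wordProd_eq cs]
    rw [wordProd_reverse, mul_inv_cancel]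
  · intro p q hpq
    have hpq' : cs.wordProd (word p) = cs.wordProd (word q) := congrArg Subtype.val hpq
    have hc := commEquiv_typeB_iff.1 ((hred p).2 _ (hred q).1 hpq'.symm)
    obtain ⟨h1, h2⟩ := p.2.eq_of_datumProj_eq q.2 fun k => by rw [← hword p, ← hword q, hc k]
    exact Subtype.ext (Prod.ext h1 h2)
  · rintro ⟨w, hw, hinv⟩
    obtain ⟨u, hu, rfl⟩ := cs.exists_isReduced w
    have huFC := hw.isFCWord cs hu rfl
    have hur : CommEquiv (typeB n) u u.reverse := by
      refine hw u u.reverse hu rfl (cs.isReduced_reverse_iff u |>.2 hu) ?_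
      rw [wordProd_reverse]
      exact inv_eq_of_mul_eq_one_left hinv
    obtain ⟨j, h, hd, hk⟩ := (isFCWord_typeB_iff.1 huFC).exists_datum (n := n) (fun x hx => by
      obtain ⟨y, -, rfl⟩ := List.mem_map.1 hx
      exact typeBRank_lt y) (commEquiv_typeB_reverse_iff.1 hur)
    refine ⟨⟨(j, h), hd⟩, Subtype.ext ?_⟩
    refine CommEquiv.wordProd_eq cs (commEquiv_typeB_iff.2 fun k => ?_)
    rw [hword, hk]

end Link

section Counting

open Classical in
/-- The finite set of paths of length `n`, built by prepending up and down steps. -/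
noncomputable def pathFinset : ℕ → Finset (ℕ → ℕ)
  | 0 => {0}
  | n + 1 => (pathFinset n).image (fun h k => k.casesOn (h 0 + 1) h) ∪
      (pathFinset n).image (fun h k => k.casesOn (h 0 - 1) h)

theorem isPath_succ_iff {n : ℕ} {h : ℕ → ℕ} : IsPath (n + 1) h ↔
    IsPath n (fun k => h (k + 1)) ∧ (h 0 = h 1 + 1 ∨ h 0 = h 1 - 1) := by
  constructor
  · rintro ⟨h1, h2⟩
    exact ⟨⟨fun k hk => h1 _ (by omega), fun k => h2 (k + 1)⟩, h2 0⟩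
  · rintro ⟨⟨h1, h2⟩, h3⟩
    refine ⟨fun k hk => ?_, fun k => ?_⟩
    · obtain ⟨k, rfl⟩ := Nat.exists_eq_add_of_le' (show 1 ≤ k by omega)
      exact h1 k (by omega)
    · rcases k with - | k
      · exact h3
      · exact h2 k

theorem mem_pathFinset {n : ℕ} {h : ℕ → ℕ} : h ∈ pathFinset n ↔ IsPath n h := by
  induction n generalizing h with
  | zero =>
    simp only [pathFinset, Finset.mem_singleton]
    constructor
    · rintro rfl
      exact ⟨fun _ _ => rfl, fun _ => .inr rfl⟩
    · intro hp
      funext k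
      exact hp.1 k (Nat.zero_le k)
  | succ n ih =>
    simp only [pathFinset, Finset.mem_union, Finset.mem_image, ih]
    rw [isPath_succ_iff]
    constructor
    · rintro (⟨g, hg, rfl⟩ | ⟨g, hg, rfl⟩)
      · exact ⟨hg, .inl rfl⟩
      · exact ⟨hg, .inr rfl⟩
    · rintro ⟨hg, h0 | h0⟩
      · refine .inl ⟨_, hg, ?_⟩
        funext k
        rcases k with - | k
        · exact h0.symm
        · rfl
      · refine .inr ⟨_, hg, ?_⟩
        funext k
        rcases k with - | k
        · exact h0.symm
        · rfl

theorem natCasesOn_injective (f : ℕ → ℕ) :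
    Function.Injective fun (h : ℕ → ℕ) (k : ℕ) => (k.casesOn (f (h 0)) h : ℕ) := by
  intro g h hgh
  funext k
  exact congrFun hgh (k + 1)

theorem card_filter_pathFinset_succ (n : ℕ) (p : ℕ → Prop) [DecidablePred p] :
    ((pathFinset (n + 1)).filter fun h => p (h 0)).card =
      ((pathFinset n).filter fun h => p (h 0 + 1)).card +
        ((pathFinset n).filter fun h => p (h 0 - 1)).card := by
  classical
  rw [pathFinset, Finset.filter_union, Finset.card_union_of_disjoint, Finset.filter_image,
    Finset.filter_image, Finset.card_image_of_injective _ (natCasesOn_injective (· + 1)),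
    Finset.card_image_of_injective _ (natCasesOn_injective (· - 1))]
  · rfl
  rw [Finset.disjoint_left]
  intro h h1 h2
  simp only [Finset.mem_filter, Finset.mem_image] at h1 h2
  obtain ⟨⟨g, -, rfl⟩, -⟩ := h1
  obtain ⟨⟨g', -, hg⟩, -⟩ := h2
  have h0 : g' 0 - 1 = g 0 + 1 := congrFun hg 0
  have h1 : g' 0 = g 0 := congrFun hg 1
  omega

theorem card_pathFinset (n : ℕ) : (pathFinset n).card = 2 ^ n := by
  induction n with
  | zero => rfl
  | succ n ih =>
    have := card_filter_pathFinset_succ n (fun _ => True)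
    simp only [Finset.filter_true] at this
    rw [this, ih]
    ring

theorem choose_succ_div_two (n : ℕ) : n.choose ((n + 1) / 2) = n.choose (n / 2) := by
  rw [← Nat.choose_symm (show n / 2 ≤ n by omega)]
  congr 1
  omega

theorem card_filter_pathFinset (n x : ℕ) :
    ((pathFinset n).filter fun h => h 0 = x).card = n.choose ((n + x + 1) / 2) := by
  induction n generalizing x with
  | zero =>
    rcases x with - | x
    · simp [pathFinset, Finset.filter_singleton]
    · rw [Nat.choose_eq_zero_of_lt (by omega)]
      simp [pathFinset, Finset.filter_singleton]
  | succ n ih =>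
    rw [card_filter_pathFinset_succ n (· = x)]
    rcases x with - | x
    · have h1 : ((pathFinset n).filter fun h => h 0 - 1 = 0) =
          ((pathFinset n).filter fun h => h 0 = 0 ∨ h 0 = 1) :=
        Finset.filter_congr fun h _ => by omega
      classical
      rw [h1, Finset.filter_or, Finset.card_union_of_disjoint, ih, ih]
      · simp only [Nat.add_eq_zero_iff, one_ne_zero, and_false, Finset.filter_false,
          Finset.card_empty, zero_add, add_zero]
        rw [choose_succ_div_two, show (n + 1 + 1) / 2 = n / 2 + 1 by omega, Nat.choose_succ_succ]
      · rw [Finset.disjoint_filter]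
        omega
    · have h1 : ((pathFinset n).filter fun h => h 0 + 1 = x + 1) =
          ((pathFinset n).filter fun h => h 0 = x) :=
        Finset.filter_congr fun h _ => by omega
      have h2 : ((pathFinset n).filter fun h => h 0 - 1 = x + 1) =
          ((pathFinset n).filter fun h => h 0 = x + 2) :=
        Finset.filter_congr fun h _ => by omega
      rw [h1, h2, ih, ih, show (n + 1 + (x + 1) + 1) / 2 = (n + x + 1) / 2 + 1 by omega,
        Nat.choose_succ_succ, show (n + (x + 2) + 1) / 2 = (n + x + 1) / 2 + 1 by omega]

theorem card_datum_pos (n : ℕ) :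
    {p : ℕ × (ℕ → ℕ) | IsPath n p.2 ∧ 1 ≤ p.1 ∧ (∀ k < p.1, p.2 k = 0) ∧ p.2 p.1 = 1}.Finite ∧
    {p : ℕ × (ℕ → ℕ) | IsPath n p.2 ∧ 1 ≤ p.1 ∧ (∀ k < p.1, p.2 k = 0) ∧ p.2 p.1 = 1}.ncard =
      n.choose (n / 2) - 1 := by
  classical
  set D := {p : ℕ × (ℕ → ℕ) | IsPath n p.2 ∧ 1 ≤ p.1 ∧ (∀ k < p.1, p.2 k = 0) ∧ p.2 p.1 = 1}
    with hD
  have himage : Prod.snd '' D = ((pathFinset n).filter fun h => h 0 = 0).erase 0 := by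
    ext h
    rw [hD]
    simp only [Set.mem_image, Set.mem_ofPred_eq, Prod.exists, exists_eq_right, Finset.coe_erase,
      Finset.coe_filter, mem_pathFinset, Set.mem_sdiff, Set.mem_singleton_iff]
    constructor
    · rintro ⟨j, hp, hj, h0, h1⟩
      refine ⟨⟨hp, h0 0 hj⟩, ?_⟩
      rintro rfl
      simp at h1
    · rintro ⟨⟨hp, h0⟩, hne⟩
      have hex : ∃ k, h k ≠ 0 := Function.ne_iff.1 hne
      have hj := Nat.find_spec hex
      have hlt (k : ℕ) (hk : k < Nat.find hex) : h k = 0 := by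
        simpa using Nat.find_min hex hk
      have hpos : 1 ≤ Nat.find hex := by
        by_contra hc
        rw [show Nat.find hex = 0 by omega] at hj
        exact hj h0
      refine ⟨Nat.find hex, hp, hpos, hlt, ?_⟩
      have h1 := hp.2 (Nat.find hex - 1)
      rw [hlt (Nat.find hex - 1) (by omega), show Nat.find hex - 1 + 1 = Nat.find hex by omega]
        at h1
      omega
  have hinj : D.InjOn Prod.snd := by
    rintro ⟨j, h⟩ ⟨-, -, h0, h1⟩ ⟨j', h'⟩ ⟨-, -, h0', h1'⟩ hh
    obtain rfl : h = h' := hh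
    simp only at h0 h1 h0' h1'
    rcases lt_trichotomy j j' with hlt | rfl | hlt
    · have := h0' j hlt
      omega
    · rfl
    · have := h0 j' hlt
      omega
  have hzero : 0 ∈ (pathFinset n).filter fun h => h 0 = 0 := by
    simp only [Finset.mem_filter, mem_pathFinset]
    exact ⟨⟨fun _ _ => rfl, fun _ => .inr rfl⟩, rfl⟩
  refine ⟨Set.Finite.of_finite_image (himage ▸ Finset.finite_toSet _) hinj, ?_⟩
  rw [← hinj.ncard_image, himage, Set.ncard_coe_finset,
    Finset.card_erase_of_mem hzero, card_filter_pathFinset, add_zero, choose_succ_div_two]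

theorem card_datum (n : ℕ) : Nat.card {p : ℕ × (ℕ → ℕ) // IsDatum n p.1 p.2} =
    2 ^ n + n.choose (n / 2) - 1 := by
  have hsplit : {p : ℕ × (ℕ → ℕ) | IsDatum n p.1 p.2} = Prod.mk 0 '' (pathFinset n : Set (ℕ → ℕ)) ∪
      {p : ℕ × (ℕ → ℕ) | IsPath n p.2 ∧ 1 ≤ p.1 ∧ (∀ k < p.1, p.2 k = 0) ∧ p.2 p.1 = 1} := by
    ext ⟨j, h⟩
    simp only [IsDatum, Set.mem_ofPred_eq, Set.mem_union, Set.mem_image, SetLike.mem_coe,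
      mem_pathFinset, Prod.mk.injEq]
    constructor
    · rintro ⟨hp, rfl | hj⟩
      · exact .inl ⟨h, hp, rfl, rfl⟩
      · exact .inr ⟨hp, hj⟩
    · rintro (⟨g, hp, rfl, rfl⟩ | ⟨hp, hj⟩)
      · exact ⟨hp, .inl rfl⟩
      · exact ⟨hp, .inr hj⟩
  have hpos : 1 ≤ n.choose (n / 2) := Nat.choose_pos (by omega)
  obtain ⟨hfin, hcard⟩ := card_datum_pos n
  change Nat.card ({p : ℕ × (ℕ → ℕ) | IsDatum n p.1 p.2} : Set _) = _
  rw [Nat.card_coe_set_eq, hsplit, Set.ncard_union_eq ?_ ((Finset.finite_toSet _).image _) hfin,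
    hcard, Set.ncard_image_of_injective _ (Prod.mk_right_injective 0), Set.ncard_coe_finset,
    card_pathFinset]
  · exact (Nat.add_sub_assoc hpos _).symm
  · rw [Set.disjoint_left]
    rintro _ ⟨h, -, rfl⟩ ⟨-, hj, -⟩
    exact absurd hj (by simp)

end Counting

/-- The number of fully commutative involutions in the Coxeter group of type `B_n`
equals `2^n + C(n, ⌊n/2⌋) - 1`. -/
theorem card_fcInvolutions_typeB (n : ℕ) (hn : 1 ≤ n) :
    Nat.card {w : (typeB n).Group // IsFCInvolution (typeB n).toCoxeterSystem w} =
      2 ^ n + Nat.choose n (n / 2) - 1 := by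
  rw [card_fcInvolutions_eq_card_datum, card_datum]
end
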